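/- arXiv:2009.11494 — 2 statements merged into one kernel-verified Lean document; each statement's English description precedes it below -/
import Mathlib

section
/- Proposition (L(A') is distributive): Let θ_{A'} be the smallest fully invariant congruence on F = FreeMonoid ℕ containing the identities {x² ≈ x³, x²y ≈ yx²} ∪ {w_n[π,τ] ≈ w_n'[π,τ] : n ≥ 1, π, τ ∈ S_n} ∪ {c_{n,m,k}[ρ] ≈ c'_{n,m,k}[ρ], d_{n,m,k}[ρ] ≈ d'_{n,m,k}[ρ] : n, m, k ≥ 0, ρ ∈ S_{n+m+k}}. Then the lattice of fully invariant congruences on F containing θ_{A'} is distributive: for all fully invariant congruences α, β, γ ⊇ θ_{A'}, α ⊔ (β ∩ γ) = (α ⊔ β) ∩ (α ⊔ γ), where ⊔ is the join in the congruence lattice of F. Equivalently, the subvariety lattice of the variety A' is distributive. -/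
/-! Common definitions: words, fully invariant congruences, identities and
named varieties from the paper. -/

/-- The free monoid over the countably infinite alphabet `ℕ`. -/
abbrev FM : Type := FreeMonoid ℕ

/-- The letters `x, y, z, s, t, h` (pairwise distinct elements of `ℕ`). -/
def xL : FM := FreeMonoid.of 0
def yL : FM := FreeMonoid.of 1
def zL : FM := FreeMonoid.of 2
def sL : FM := FreeMonoid.of 3
def tL : FM := FreeMonoid.of 4
def hL : FM := FreeMonoid.of 5
/-- The indexed letters `z_i` and `t_i` (0-based; pairwise distinct, and distinct
from the named letters above). -/
def zV (i : ℕ) : FM := FreeMonoid.of (10 + 2 * i)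
def tV (i : ℕ) : FM := FreeMonoid.of (11 + 2 * i)

/-- A congruence on the free monoid is fully invariant if it is stable under all
monoid endomorphisms. -/
def IsFullyInvariant (θ : Con FM) : Prop :=
  ∀ (σ : FM →* FM) (u v : FM), θ u v → θ (σ u) (σ v)

/-- The smallest fully invariant congruence on `FM` containing a set of identities. -/
def fiCon (E : Set (FM × FM)) : Con FM :=
  sInf {c : Con FM | IsFullyInvariant c ∧ ∀ p ∈ E, c p.1 p.2}

/-- Two congruences (relations) permute: `α ∘ β = β ∘ α`. -/
def Permute (α β : Con FM) : Prop :=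
  Relation.Comp (⇑α) (⇑β) = Relation.Comp (⇑β) (⇑α)

/-- A monoid `M` satisfies the identity `p.1 ≈ p.2`. -/
def MSatisfies (M : Type*) [Monoid M] (p : FM × FM) : Prop :=
  ∀ φ : FM →* M, φ p.1 = φ p.2

/-- A monoid `M` satisfies all identities of a congruence `θ`. -/
def SatisfiesAll (θ : Con FM) (M : Type*) [Monoid M] : Prop :=
  ∀ u v : FM, θ u v → MSatisfies M (u, v)

/-- Every element of the monoid `M` has a two-sided inverse, i.e. `M` is a group. -/
def IsGroupMonoid (M : Type*) [Monoid M] : Prop :=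
  ∀ m : M, ∃ m' : M, m * m' = 1 ∧ m' * m = 1

/-- The dual of a congruence: `θ^δ = {(rev u, rev v) : (u, v) ∈ θ}`. -/
def dualCon (θ : Con FM) : Con FM where
  r a b := θ a.reverse b.reverse
  iseqv := ⟨fun _ => θ.refl _, fun h => θ.symm h, fun h h' => θ.trans h h'⟩
  mul' := fun {a b c d} h₁ h₂ => by
    show θ (a * c).reverse (b * d).reverse
    rw [FreeMonoid.reverse_mul, FreeMonoid.reverse_mul]
    exact θ.mul h₂ h₁

/-- σ1 : `xysxty ≈ yxsxty`. -/
def idσ1 : FM × FM := (xL*yL*sL*xL*tL*yL, yL*xL*sL*xL*tL*yL)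
/-- σ2 : `xsytxy ≈ xsytyx`. -/
def idσ2 : FM × FM := (xL*sL*yL*tL*xL*yL, xL*sL*yL*tL*yL*xL)
/-- σ3 : `xsxyty ≈ xsyxty`. -/
def idσ3 : FM × FM := (xL*sL*xL*yL*tL*yL, xL*sL*yL*xL*tL*yL)
/-- α1 : `xysxtxhy ≈ yxsxtxhy`. -/
def idα1 : FM × FM := (xL*yL*sL*xL*tL*xL*hL*yL, yL*xL*sL*xL*tL*xL*hL*yL)
/-- α2 : `xysxtyhx ≈ yxsxtyhx`. -/
def idα2 : FM × FM := (xL*yL*sL*xL*tL*yL*hL*xL, yL*xL*sL*xL*tL*yL*hL*xL)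
/-- α3 : `xysytxhx ≈ yxsytxhx`. -/
def idα3 : FM × FM := (xL*yL*sL*yL*tL*xL*hL*xL, yL*xL*sL*yL*tL*xL*hL*xL)

/-- `aIdent i` is the identity `α_i` for `i ∈ {1, 2, 3}`. -/
def aIdent (i : ℕ) : FM × FM := if i = 1 then idα1 else if i = 2 then idα2 else idα3
/-- `bIdent i` is `β_i`, obtained from `α_i` by reversing both sides. -/
def bIdent (i : ℕ) : FM × FM := ((aIdent i).1.reverse, (aIdent i).2.reverse)

/-- The ordered product `f 0 * f 1 * ⋯ * f (n-1)`. -/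
def prodRange (n : ℕ) (f : ℕ → FM) : FM := ((List.range n).map f).prod
/-- The ordered product `f 0 * f 1 * ⋯ * f (n-1)` over `Fin n`. -/
def prodFin (n : ℕ) (f : Fin n → FM) : FM := ((List.finRange n).map f).prod

/-- The word `w_n[π,τ]` (0-based indices). -/
def wWord (n : ℕ) (π τ : Equiv.Perm (Fin n)) : FM :=
  prodRange n (fun i => zV i * tV i) * xL *
    prodFin n (fun i => zV (π i) * zV (n + τ i)) * xL *
    prodRange n (fun i => tV (n + i) * zV (n + i))

/-- The word `w_n'[π,τ]`. -/
def wWord' (n : ℕ) (π τ : Equiv.Perm (Fin n)) : FM :=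
  prodRange n (fun i => zV i * tV i) * (xL * xL) *
    prodFin n (fun i => zV (π i) * zV (n + τ i)) *
    prodRange n (fun i => tV (n + i) * zV (n + i))

/-- The word `c_{n,m}[ρ]`. -/
def cWord (n m : ℕ) (ρ : Equiv.Perm (Fin (n + m))) : FM :=
  prodRange n (fun i => zV i * tV i) * (xL * yL) * tL *
    prodRange m (fun i => zV (n + i) * tV (n + i)) * xL *
    prodFin (n + m) (fun i => zV (ρ i)) * yL

/-- The word `c'_{n,m}[ρ]`. -/
def cWord' (n m : ℕ) (ρ : Equiv.Perm (Fin (n + m))) : FM :=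
  prodRange n (fun i => zV i * tV i) * (yL * xL) * tL *
    prodRange m (fun i => zV (n + i) * tV (n + i)) * xL *
    prodFin (n + m) (fun i => zV (ρ i)) * yL

/-- The word `c_{n,m,k}[ρ]`. -/
def cWord3 (n m k : ℕ) (ρ : Equiv.Perm (Fin (n + m + k))) : FM :=
  prodRange n (fun i => zV i * tV i) * (xL * yL) * tL *
    prodRange m (fun i => zV (n + i) * tV (n + i)) * xL *
    prodFin (n + m + k) (fun i => zV (ρ i)) * yL *
    prodRange k (fun i => tV (n + m + i) * zV (n + m + i))

/-- The word `c'_{n,m,k}[ρ]`. -/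
def cWord3' (n m k : ℕ) (ρ : Equiv.Perm (Fin (n + m + k))) : FM :=
  prodRange n (fun i => zV i * tV i) * (yL * xL) * tL *
    prodRange m (fun i => zV (n + i) * tV (n + i)) * xL *
    prodFin (n + m + k) (fun i => zV (ρ i)) * yL *
    prodRange k (fun i => tV (n + m + i) * zV (n + m + i))

/-- The equational theory of `D_∞`. -/
def θDinf : Con FM :=
  fiCon {(xL^2, xL^3), (xL^2 * yL, yL * xL^2), idσ1, idσ2, idσ3}
/-- The equational theory of `N`. -/
def θN : Con FM :=
  fiCon {(xL^2, xL^3), (xL^2 * yL, yL * xL^2), (xL*yL*xL*zL*xL, xL^2*yL*zL), idσ2, idσ3}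
/-- The equational theory of `K`. -/
def θK : Con FM :=
  fiCon {(xL^2*yL, xL^2*yL*xL), (xL*yL*xL, xL*yL*xL^2), (xL^2*yL^2, yL^2*xL^2)}
/-- The identity basis of `P_n`. -/
def basisP (n : ℕ) : Set (FM × FM) :=
  {(xL^n, xL^(n+1)), (xL^n * yL, yL * xL^n), (xL^2*yL, xL*yL*xL)}
/-- The equational theory of `P_n`. -/
def θP (n : ℕ) : Con FM := fiCon (basisP n)
/-- The equational theory of `R`. -/
def θR : Con FM :=
  fiCon ({(xL^2, xL^3), (xL^2*yL, yL*xL^2), idσ1, idσ2} ∪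
    {p : FM × FM | ∃ (n : ℕ) (π τ : Equiv.Perm (Fin n)),
        1 ≤ n ∧ p = (wWord n π τ, wWord' n π τ)})
/-- The equational theory of `Q_{r,s}`. -/
def θQ (r s : ℕ) : Con FM :=
  fiCon ({(xL^2, xL^3), (xL^2*yL, yL*xL^2), idσ3} ∪
    {p : FM × FM | ∃ i : ℕ, (i = 1 ∨ i = 2 ∨ i = 3) ∧ i ≠ r ∧ p = aIdent i} ∪
    {p : FM × FM | ∃ j : ℕ, (j = 1 ∨ j = 2 ∨ j = 3) ∧ j ≠ s ∧ p = bIdent j} ∪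
    {p : FM × FM | ∃ (n m : ℕ) (ρ : Equiv.Perm (Fin (n + m))),
        p = (cWord n m ρ, cWord' n m ρ) ∨
        p = ((cWord n m ρ).reverse, (cWord' n m ρ).reverse)})
/-- The equational theory of the variety `SL` of semilattice monoids. -/
def θSL : Con FM := fiCon {(xL, xL^2), (xL*yL, yL*xL)}

/-- `u` is a factor (contiguous subword) of `w`. -/
def IsFactor (u w : FM) : Prop := ∃ p q : FM, p * u * q = w

lemma isFactor_left {a b w : FM} (h : IsFactor (a * b) w) : IsFactor a w := by
  obtain ⟨p, q, hpq⟩ := h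
  exact ⟨p, b * q, by rw [← hpq]; simp [mul_assoc]⟩

lemma isFactor_right {a b w : FM} (h : IsFactor (a * b) w) : IsFactor b w := by
  obtain ⟨p, q, hpq⟩ := h
  exact ⟨p * a, q, by rw [← hpq]; simp [mul_assoc]⟩

/-- The Rees congruence associated with the ideal of non-factors of `w`. -/
def reesCon (w : FM) : Con FM where
  r u v := u = v ∨ (¬ IsFactor u w ∧ ¬ IsFactor v w)
  iseqv := by
    refine ⟨fun _ => Or.inl rfl, ?_, ?_⟩
    · intro a b h
      rcases h with rfl | ⟨h1, h2⟩
      · exact Or.inl rfl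
      · exact Or.inr ⟨h2, h1⟩
    · intro a b c h h'
      rcases h with rfl | ⟨h1, h2⟩
      · exact h'
      · rcases h' with rfl | ⟨h3, h4⟩
        · exact Or.inr ⟨h1, h2⟩
        · exact Or.inr ⟨h1, h4⟩
  mul' := by
    rintro a b c d (rfl | ⟨h1, h2⟩) (rfl | ⟨h3, h4⟩)
    · exact Or.inl rfl
    · exact Or.inr ⟨fun h => h3 (isFactor_right h), fun h => h4 (isFactor_right h)⟩
    · exact Or.inr ⟨fun h => h1 (isFactor_left h), fun h => h2 (isFactor_left h)⟩
    · exact Or.inr ⟨fun h => h1 (isFactor_left h), fun h => h2 (isFactor_left h)⟩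

/-- The Rees quotient monoid `S(w)`. -/
abbrev SMon (w : FM) : Type := (reesCon w).Quotient

/-- The number of occurrences of the letter `a` in the word `w`. -/
def occ (w : FM) (a : ℕ) : ℕ := (FreeMonoid.toList w).count a

/-- A word in which every letter occurs at most once. -/
def LinearW (w : FM) : Prop := ∀ a : ℕ, occ w a ≤ 1

/-- Assemble the word `b0 * t_1 * b_1 * ⋯ * t_m * b_m` from a first block and a list
of (simple letter, block) pairs. -/
def assemble (b0 : FM) (rest : List (ℕ × FM)) : FM :=
  b0 * (rest.map (fun p => FreeMonoid.of p.1 * p.2)).prod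

/-- `(b0, rest)` is the decomposition of `w` into alternating simple letters and blocks
consisting of multiple letters. -/
def IsDecomposition (w : FM) (b0 : FM) (rest : List (ℕ × FM)) : Prop :=
  w = assemble b0 rest ∧
  (∀ p ∈ rest, occ w p.1 = 1) ∧
  (∀ a ∈ FreeMonoid.toList b0, 2 ≤ occ w a) ∧
  (∀ p ∈ rest, ∀ a ∈ FreeMonoid.toList p.2, 2 ≤ occ w a)

/-- The identity `u ≈ v` is linear-balanced. -/
def LinearBalanced (u v : FM) : Prop :=
  ∃ (b0 c0 : FM) (urest vrest : List (ℕ × FM)),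
    IsDecomposition u b0 urest ∧ IsDecomposition v c0 vrest ∧
    urest.map Prod.fst = vrest.map Prod.fst ∧
    ∀ a : ℕ, (2 ≤ occ u a ∨ 2 ≤ occ v a) →
      occ b0 a = occ c0 a ∧ occ b0 a ≤ 1 ∧
      ∀ q ∈ urest.zip vrest, occ q.1.2 a = occ q.2.2 a ∧ occ q.1.2 a ≤ 1

/-- `w` is an isoterm for `θ`. -/
def IsIsoterm (θ : Con FM) (w : FM) : Prop := ∀ w' : FM, θ w w' → w' = w

/-- The identity basis of the variety `A'`. -/
def basisA' : Set (FM × FM) :=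
  {(xL ^ 2, xL ^ 3), (xL ^ 2 * yL, yL * xL ^ 2)} ∪
  {p : FM × FM | ∃ (n : ℕ) (π τ : Equiv.Perm (Fin n)),
      1 ≤ n ∧ p = (wWord n π τ, wWord' n π τ)} ∪
  {p : FM × FM | ∃ (n m k : ℕ) (ρ : Equiv.Perm (Fin (n + m + k))),
      p = (cWord3 n m k ρ, cWord3' n m k ρ) ∨
      p = ((cWord3 n m k ρ).reverse, (cWord3' n m k ρ).reverse)}

/-- The equational theory of `A'`. -/
def θA' : Con FM := fiCon basisA'

/-- A fully invariant congruence on words over `ℕ`, seen as a relation on lists, that satisfies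
the rewriting rules of the variety `A'`. -/
structure WordCong (r : List ℕ → List ℕ → Prop) : Prop where
  refl : ∀ u, r u u
  symm : ∀ {u v}, r u v → r v u
  trans : ∀ {u v w}, r u v → r v w → r u w
  app : ∀ {a b c d}, r a b → r c d → r (a ++ c) (b ++ d)
  sub : ∀ (s : ℕ → List ℕ) {u v}, r u v → r (u.flatMap s) (v.flatMap s)
  cube : ∀ x, r [x, x, x] [x, x]
  central : ∀ x l, r (x :: x :: l) (l ++ [x, x])
  square : ∀ p x a q, a.Nodup → (∀ y ∈ a, y ∈ p ∨ y ∈ q) →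
    r (p ++ x :: (a ++ x :: q)) (x :: x :: (p ++ a ++ q))
  swap : ∀ p x y q a s, a.Nodup → (∀ z ∈ a, z ∈ p ∨ z ∈ q ∨ z ∈ s) →
    r (p ++ x :: y :: (q ++ x :: (a ++ y :: s))) (p ++ y :: x :: (q ++ x :: (a ++ y :: s)))
  swap_rev : ∀ s y a x q p, a.Nodup → (∀ z ∈ a, z ∈ p ∨ z ∈ q ∨ z ∈ s) →
    r (s ++ y :: (a ++ x :: (q ++ y :: x :: p))) (s ++ y :: (a ++ x :: (q ++ x :: y :: p)))

/-- The word `l` with all occurrences of the letter `x` removed. -/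
def del (x : ℕ) (l : List ℕ) : List ℕ := l.filter (fun y => y ≠ x)

/-- No two adjacent letters of the list satisfy `D`. -/
def Sparse (D : ℕ → Prop) (l : List ℕ) : Prop := l.IsChain (fun y z => ¬(D y ∧ D z))

section Words

variable {x y z t : ℕ} {l m : List ℕ} {D : ℕ → Prop}

@[simp] lemma del_nil : del x [] = [] := rfl

@[simp] lemma del_append : del x (l ++ m) = del x l ++ del x m := List.filter_append ..

@[simp] lemma del_cons_self : del x (x :: l) = del x l := by simp [del]

lemma del_cons_ne (h : y ≠ x) : del x (y :: l) = y :: del x l := by simp [del, h]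

@[simp] lemma mem_del : y ∈ del x l ↔ y ∈ l ∧ y ≠ x := by simp [del]

lemma del_of_notMem (h : x ∉ l) : del x l = l := by
  simp only [del, List.filter_eq_self]
  intro a ha
  simp only [ne_eq, decide_not, Bool.not_eq_eq_eq_not, Bool.not_true, decide_eq_false_iff_not]
  rintro rfl
  exact h ha

lemma del_filter (K : ℕ → Bool) : del x (l.filter K) = (del x l).filter K := by
  simp only [del, List.filter_filter, Bool.and_comm]

lemma del_comm : del x (del y l) = del y (del x l) := del_filter _

lemma filter_eq_flatMap (K : ℕ → Bool) :
    l.filter K = l.flatMap (fun a => if K a then [a] else []) := by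
  induction l with
  | nil => rfl
  | cons a l ih => by_cases h : K a <;> simp [h, ih]

lemma flatMap_congr_mem {f g : ℕ → List ℕ} (h : ∀ a ∈ l, f a = g a) :
    l.flatMap f = l.flatMap g := by
  induction l with
  | nil => rfl
  | cons a l ih =>
    simp only [List.flatMap_cons]
    rw [h a (by simp), ih fun b hb => h b (by simp [hb])]

lemma flatMap_eq_self {f : ℕ → List ℕ} (h : ∀ a ∈ l, f a = [a]) : l.flatMap f = l := by
  rw [flatMap_congr_mem h]; simp

lemma filter_flatMap_ne (f : ℕ → List ℕ) (hf : f x = [x]) :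
    del x (l.flatMap f) = del x ((del x l).flatMap f) := by
  induction l with
  | nil => rfl
  | cons a l ih =>
    by_cases h : a = x
    · subst h; simp [hf, ih]
    · rw [del_cons_ne h]; simp [ih]

lemma Sparse.reverse (h : Sparse D l) : Sparse D l.reverse := by
  unfold Sparse at *
  rw [List.isChain_reverse]
  exact h.imp fun a b hab => by tauto

lemma sparse_append_cons_cons :
    Sparse D (l ++ y :: z :: m) ↔ Sparse D (l ++ [y]) ∧ ¬(D y ∧ D z) ∧ Sparse D (z :: m) := by
  simp only [Sparse, List.isChain_append_cons_cons]

@[simp] lemma sparse_cons_cons :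
    Sparse D (y :: z :: m) ↔ ¬(D y ∧ D z) ∧ Sparse D (z :: m) := by
  simp only [Sparse, List.isChain_cons_cons]

@[simp] lemma sparse_nil : Sparse D [] := by simp [Sparse]

@[simp] lemma sparse_singleton : Sparse D [y] := by simp [Sparse]

lemma sparse_split : Sparse D (l ++ y :: m) ↔ Sparse D (l ++ [y]) ∧ Sparse D (y :: m) :=
  List.isChain_split

lemma Sparse.left (h : Sparse D (l ++ m)) : Sparse D l := (List.isChain_append.1 h).1

lemma Sparse.right (h : Sparse D (l ++ m)) : Sparse D m := (List.isChain_append.1 h).2.1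

lemma Sparse.tail (h : Sparse D (y :: m)) : Sparse D m := by
  cases m with
  | nil => simp
  | cons z m => exact (sparse_cons_cons.1 h).2

lemma sparse_cons_of_not (hy : ¬ D y) (h : Sparse D m) : Sparse D (y :: m) := by
  cases m with
  | nil => simp
  | cons z m => exact sparse_cons_cons.2 ⟨fun h => hy h.1, h⟩

lemma sparse_concat_of_not (hy : ¬ D y) (h : Sparse D l) : Sparse D (l ++ [y]) := by
  have := (sparse_cons_of_not hy h.reverse).reverse
  simpa using this

/-- A failure of sparseness exhibits two adjacent letters. -/
lemma exists_of_not_sparse (h : ¬ Sparse D l) :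
    ∃ l₁ e f l₂, l = l₁ ++ e :: f :: l₂ ∧ D e ∧ D f := by
  induction l with
  | nil => simp at h
  | cons a l ih =>
    cases l with
    | nil => simp at h
    | cons b l =>
      by_cases hd : D a ∧ D b
      · exact ⟨[], a, b, l, rfl, hd.1, hd.2⟩
      · obtain ⟨l₁, e, f, l₂, h1, h2⟩ := ih fun h' => h (sparse_cons_cons.2 ⟨hd, h'⟩)
        exact ⟨a :: l₁, e, f, l₂, by rw [h1]; rfl, h2⟩

lemma not_sparse_of_adjacent {l₁ l₂ : List ℕ} (hx : D x) (hy : D y) :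
    ¬ Sparse D (l₁ ++ x :: y :: l₂) := by
  rw [sparse_append_cons_cons]; tauto

/-- A failure of sparseness of a filtered list, read off in the list itself. -/
lemma exists_of_filter_eq_append (K : ℕ → Bool) {e f : ℕ} {l₁ l₂ : List ℕ}
    (h : l.filter K = l₁ ++ e :: f :: l₂) :
    ∃ s₁ a s₂, l = s₁ ++ e :: (a ++ f :: s₂) ∧ (∀ y ∈ a, ¬ K y) := by
  obtain ⟨s₁, s, rfl, -, hs⟩ := List.filter_eq_append_iff.1 h
  obtain ⟨a, b, rfl, h3, h4, hb⟩ := List.filter_eq_cons_iff.1 hs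
  obtain ⟨a', b', rfl, h5, h6, hb'⟩ := List.filter_eq_cons_iff.1 hb
  exact ⟨s₁ ++ a, a', b', by simp, h5⟩

end Words

namespace WordCong

variable {r : List ℕ → List ℕ → Prop} (hr : WordCong r) {x y z t : ℕ} {u v w l m : List ℕ}
include hr

lemma consL (h : r u v) : r (x :: u) (x :: v) := hr.app (hr.refl [x]) h

lemma appL (h : r u v) : r (l ++ u) (l ++ v) := hr.app (hr.refl l) h

lemma appR (h : r u v) : r (u ++ l) (v ++ l) := hr.app h (hr.refl l)

lemma restrict (K : ℕ → Bool) (h : r u v) : r (u.filter K) (v.filter K) := by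
  rw [filter_eq_flatMap, filter_eq_flatMap]; exact hr.sub _ h

lemma erase (h : r u v) : r (del x u) (del x v) := hr.restrict _ h

/-- Squares of letters are central. -/
lemma move_sq : r (l ++ x :: x :: m) (x :: x :: (l ++ m)) := by
  have h := hr.symm (hr.central x l)
  simpa using hr.appR (l := m) h

lemma absorb_del : r (x :: x :: l) (x :: x :: del x l) := by
  induction l with
  | nil => exact hr.refl _
  | cons y l ih =>
    by_cases h : y = x
    · subst h
      rw [del_cons_self]
      exact hr.trans (hr.appR (l := l) (hr.cube y)) ih
    · rw [del_cons_ne h]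
      refine hr.trans (hr.symm (hr.move_sq (x := x) (l := [y]) (m := l))) ?_
      exact hr.trans (hr.consL ih) (hr.move_sq (x := x) (l := [y]) (m := del x l))

lemma absorb_of_sq (h : r w (x :: x :: u)) : r w (x :: x :: del x u) :=
  hr.trans h hr.absorb_del

/-- A letter occurring twice with only repeated letters in between can be made a square. -/
lemma absorb_block (p a q : List ℕ) (x : ℕ)
    (h : ∀ y ∈ a, y ≠ x → 2 ≤ (p ++ x :: (a ++ x :: q)).count y) :
    r (p ++ x :: (a ++ x :: q)) (x :: x :: del x (p ++ a ++ q)) := by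
  induction hn : a.length using Nat.strong_induction_on generalizing p a q x with
  | _ n ih =>
  subst hn
  by_cases hx : x ∈ a
  · obtain ⟨a₁, a₂, rfl⟩ := List.append_of_mem hx
    have := ih a₁.length (by simp) p a₁ (a₂ ++ x :: q) x (fun y hy hne => by
      have := h y (by simp [hy]) hne
      simpa using this) rfl
    simpa using this
  by_cases hd : a.Nodup
  · refine hr.absorb_of_sq (hr.square p x a q hd fun y hy => ?_)
    have hne : y ≠ x := fun e => hx (e ▸ hy)
    have h1 := h y hy hne
    have h2 := List.nodup_iff_count_le_one.1 hd y
    by_contra hcon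
    push Not at hcon
    have h3 := List.count_eq_zero_of_not_mem hcon.1
    have h4 := List.count_eq_zero_of_not_mem hcon.2
    have h5 : (x == y) = false := by simp [Ne.symm hne]
    simp only [List.count_append, List.count_cons, h5] at h1
    simp at h1
    omega
  · rw [List.nodup_iff_count_le_one] at hd
    push Not at hd
    obtain ⟨y, hy⟩ := hd
    have hya : y ∈ a := List.count_pos_iff.1 (by omega)
    obtain ⟨a₁, b, rfl, hya₁⟩ := List.eq_append_cons_of_mem hya
    have hyb : y ∈ b := by
      rw [List.count_append, List.count_eq_zero_of_not_mem hya₁] at hy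
      simp only [List.count_cons_self] at hy
      exact List.count_pos_iff.1 (by omega)
    obtain ⟨a₂, a₃, rfl, hya₂⟩ := List.eq_append_cons_of_mem hyb
    have hyx : y ≠ x := fun e => hx (e ▸ hya)
    obtain ⟨W, hW⟩ : ∃ W, W = p ++ x :: ((a₁ ++ y :: (a₂ ++ y :: a₃)) ++ x :: q) := ⟨_, rfl⟩
    rw [← hW]
    have e1 : r W (y :: y :: del y ((p ++ x :: a₁) ++ a₂ ++ (a₃ ++ x :: q))) := by
      have := ih a₂.length (by simp; omega) (p ++ x :: a₁) a₂ (a₃ ++ x :: q) y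
        (fun c hc hne => by
          by_cases hcx : c = x
          · subst hcx
            simp only [List.count_append, List.count_cons, beq_self_eq_true, if_true]
            omega
          · have := h c (by simp [hc]) hcx
            simpa only [List.append_assoc, List.cons_append] using this) rfl
      simpa [hW] using this
    have e2 : r W (y :: y :: (p ++ x :: (a₁ ++ a₂ ++ a₃ ++ x :: q))) := by
      refine hr.trans e1 (hr.symm ?_)
      have := hr.absorb_del (x := y) (l := p ++ x :: (a₁ ++ a₂ ++ a₃ ++ x :: q))
      simpa using this
    have e3 := ih (a₁ ++ a₂ ++ a₃).length (by simp) (y :: y :: p) (a₁ ++ a₂ ++ a₃) q x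
        (fun c hc hne => by
          by_cases hcy : c = y
          · subst hcy; simp
          · have := h c (by simp at hc ⊢; tauto) hne
            have h6 : (y == c) = false := by simp [Ne.symm hcy]
            simp [List.count_append, List.count_cons, h6] at this ⊢
            omega) rfl
    have e3' : r W (x :: x :: y :: y :: del x (p ++ (a₁ ++ a₂ ++ a₃) ++ q)) := by
      refine hr.trans e2 ?_
      simpa [del_cons_ne hyx] using e3
    refine hr.trans e3' ?_
    -- return the letter `y` to its original positions
    have e4 := ih a₂.length (by simp; omega) (x :: x :: del x (p ++ a₁)) (del x a₂)
    have hxa : x ∉ a₁ ∧ x ∉ a₂ ∧ x ∉ a₃ := by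
      simp at hx; tauto
    have e5 : r (x :: x :: del x (p ++ a₁) ++ y :: (a₂ ++ y :: del x (a₃ ++ q)))
        (y :: y :: del y (x :: x :: del x (p ++ a₁) ++ a₂ ++ del x (a₃ ++ q))) := by
      refine ih a₂.length (by simp; omega) _ _ _ _ (fun c hc hne => ?_) rfl
      have hcx : c ≠ x := fun e => hxa.2.1 (e ▸ hc)
      have := h c (by simp [hc]) hcx
      have h6 : (y == c) = false := by simp [Ne.symm hne]
      have h7 : (x == c) = false := by simp [Ne.symm hcx]
      have h8 : ∀ l : List ℕ, (del x l).count c = l.count c := fun l => by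
        unfold del; rw [List.count_filter (by simpa using hcx)]
      simp only [List.count_append, List.count_cons, h6, h7, h8] at this ⊢
      simp at this ⊢
      omega
    have e6 := hr.absorb_del (x := y)
      (l := x :: x :: del x (p ++ a₁) ++ a₂ ++ del x (a₃ ++ q))
    have e7 : r (x :: x :: y :: y :: del x (p ++ (a₁ ++ a₂ ++ a₃) ++ q))
        (y :: y :: (x :: x :: del x (p ++ a₁) ++ a₂ ++ del x (a₃ ++ q))) := by
      have := hr.move_sq (x := y) (l := [x, x]) (m := del x (p ++ (a₁ ++ a₂ ++ a₃) ++ q))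
      simpa [del_of_notMem hxa.1, del_of_notMem hxa.2.1, del_of_notMem hxa.2.2] using this
    have e8 := hr.trans e7 (hr.trans e6 (hr.symm e5))
    simpa [del_of_notMem hxa.1, del_of_notMem hxa.2.1, del_of_notMem hxa.2.2, del_cons_ne hyx]
      using e8

end WordCong

/-- The relation identifies `l ++ m` and `m ++ l` for all words. -/
def Commutes (r : List ℕ → List ℕ → Prop) : Prop := ∀ l m, r (l ++ m) (m ++ l)

lemma filter_eq_replicate (l : List ℕ) (x : ℕ) :
    l.filter (fun y => y = x) = List.replicate (l.count x) x := by
  induction l with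
  | nil => rfl
  | cons a l ih =>
    by_cases h : a = x
    · subst h; simp [ih, List.replicate_succ]
    · simp [ih, h]

lemma restrict_pair_of_nodup {x y : ℕ} {l : List ℕ} (hl : (x :: l).Nodup) (hy : y ∈ l) :
    (x :: l).filter (fun t => t = x ∨ t = y) = [x, y] := by
  obtain ⟨hx, hl⟩ := List.nodup_cons.1 hl
  have : l.filter (fun t => t = x ∨ t = y) = l.filter (fun t => t = y) :=
    List.filter_congr fun t ht => by
      have : t ≠ x := fun e => hx (e ▸ ht)
      simp [this]
  rw [List.filter_cons_of_pos (by simp), this, filter_eq_replicate,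
    List.count_eq_one_of_mem hl hy]
  rfl

namespace WordCong

variable {r : List ℕ → List ℕ → Prop} (hr : WordCong r) {x y z t : ℕ} {u v w l m : List ℕ}
include hr

lemma replicate_two (n : ℕ) : r (List.replicate (n + 2) x) [x, x] := by
  induction n with
  | zero => exact hr.refl _
  | succ n ih => exact hr.trans (hr.consL ih) (hr.cube x)

lemma commutes_of_pair (hxy : x ≠ y) (h : r [x, y] [y, x]) : Commutes r := by
  intro l m
  have := hr.sub (fun a => if a = x then l else if a = y then m else []) h
  simpa [hxy, hxy.symm] using this

lemma pair_of_commutes (h : Commutes r) : r (x :: y :: l) (y :: x :: l) :=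
  hr.appR (h [x] [y])

lemma commutes_of_idem (h : r [x] [x, x]) : Commutes r := by
  intro l m
  have hl : ∀ l, r l (l ++ l) := fun l => by simpa using hr.sub (fun _ => l) h
  have hc : r (l ++ l ++ m) (m ++ l ++ l) := by
    have := hr.sub (fun a => if a = 0 then l else m) (hr.central 0 [1])
    simpa using this
  refine hr.trans (hr.appR (hl l)) (hr.trans hc ?_)
  simpa using hr.appL (l := m) (hr.symm (hl l))

lemma idem_any (h : r [x] [x, x]) (y : ℕ) : r [y] [y, y] := by
  simpa using hr.sub (fun _ => [y]) h

lemma idem_of_trivial (h : r [] [x]) (y : ℕ) : r [y] [y, y] := by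
  have := hr.sub (fun _ => [y]) h
  exact hr.consL (by simpa using this)

lemma count_replicate (h : r u v) (x : ℕ) :
    r (List.replicate (u.count x) x) (List.replicate (v.count x) x) := by
  have := hr.restrict (fun y => decide (y = x)) h
  rwa [filter_eq_replicate, filter_eq_replicate] at this

lemma trivial_of_replicate {n : ℕ} (h : r [] (List.replicate (n + 1) x)) : r [] [x] := by
  cases n with
  | zero => exact h
  | succ n =>
    have h2 : r [] [x, x] := hr.trans h (hr.replicate_two n)
    have h3 : r [x] [x, x, x] := hr.consL h2
    exact hr.symm (hr.trans h3 (hr.trans (hr.cube x) (hr.symm h2)))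

lemma idem_of_count (h : r u v) (hu : u.count x ≤ 1) (hne : u.count x ≠ v.count x) (y : ℕ) :
    r [y] [y, y] := by
  have hc := hr.count_replicate h x
  generalize u.count x = i at *
  generalize v.count x = j at *
  obtain rfl | rfl : i = 0 ∨ i = 1 := by omega
  · obtain ⟨j, rfl⟩ := Nat.exists_eq_succ_of_ne_zero hne.symm
    exact hr.idem_of_trivial (hr.trivial_of_replicate hc) y
  · match j with
    | 0 => exact hr.idem_of_trivial (hr.symm hc) y
    | 1 => exact absurd rfl hne
    | j + 2 => exact hr.idem_any (hr.trans hc (hr.replicate_two j)) y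

lemma count_eq (hc : ¬ Commutes r) (h : r u v) (hu : u.count x ≤ 1) : v.count x = u.count x := by
  by_contra hne
  exact hc (hr.commutes_of_idem (hr.idem_of_count h hu (Ne.symm hne) 0))

lemma two_le_count (hc : ¬ Commutes r) (h : r u v) (hu : 2 ≤ u.count x) : 2 ≤ v.count x := by
  by_contra hlt
  have := hr.count_eq hc (hr.symm h) (x := x) (by omega)
  omega

/-- Words in which no letter is repeated are isoterms unless the relation is commutative. -/
lemma eq_of_nodup (hc : ¬ Commutes r) (h : r u v) (hu : u.Nodup) : u = v := by
  have hp : u.Perm v := List.perm_iff_count.2 fun x =>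
    (hr.count_eq hc h (List.nodup_iff_count_le_one.1 hu x)).symm
  induction u generalizing v with
  | nil => exact (List.nil_perm.1 hp).symm
  | cons a u ih =>
    have hv := hp.nodup_iff.1 hu
    cases v with
    | nil => simp at hp
    | cons b v =>
      by_cases hab : a = b
      · subst hab
        have h' := hr.erase (x := a) h
        rw [del_cons_self, del_cons_self, del_of_notMem (List.nodup_cons.1 hu).1,
          del_of_notMem (List.nodup_cons.1 hv).1] at h'
        rw [ih h' (List.nodup_cons.1 hu).2 (List.Perm.cons_inv hp)]
      · exfalso
        have ha : a ∈ v := by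
          have := hp.mem_iff.1 (List.mem_cons_self (a := a)); simp [hab] at this; exact this
        have hb : b ∈ u := by
          have := hp.mem_iff.2 (List.mem_cons_self (a := b)); simp [Ne.symm hab] at this; exact this
        have h' := hr.restrict (fun t => t = a ∨ t = b) h
        rw [restrict_pair_of_nodup hu hb] at h'
        have e : (fun t => decide (t = a ∨ t = b)) = fun t => decide (t = b ∨ t = a) := by
          funext t; simp [or_comm]
        rw [e, restrict_pair_of_nodup hv ha] at h'
        exact hc (hr.commutes_of_pair hab h')

lemma to_front (hc : Commutes r) : r u (List.replicate (u.count x) x ++ del x u) := by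
  induction u with
  | nil => exact hr.refl _
  | cons a u ih =>
    by_cases h : a = x
    · subst h
      simpa [List.replicate_succ] using hr.consL ih
    · rw [del_cons_ne h, List.count_cons_of_ne h]
      refine hr.trans (hr.consL ih) ?_
      simpa using hr.appR (l := del x u) (hc [a] (List.replicate (u.count x) x))

lemma of_count (hc : Commutes r)
    (h : ∀ x, r (List.replicate (u.count x) x) (List.replicate (v.count x) x)) : r u v := by
  induction hn : u.length + v.length using Nat.strong_induction_on generalizing u v with
  | _ n ih =>
  subst hn
  by_cases hx : ∃ x, x ∈ u ∨ x ∈ v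
  · obtain ⟨x, hx⟩ := hx
    have lt : ∀ w : List ℕ, x ∈ w → (del x w).length < w.length := fun w hw => by
      unfold del
      rw [List.length_filter_lt_length_iff_exists]
      exact ⟨x, hw, by simp⟩
    have le : ∀ w : List ℕ, (del x w).length ≤ w.length := fun w => List.length_filter_le ..
    have hd : r (del x u) (del x v) := by
      refine ih _ ?_ (fun y => ?_) rfl
      · have := le u; have := le v
        rcases hx with hx | hx
        · have := lt _ hx; omega
        · have := lt _ hx; omega
      · by_cases hyx : y = x
        · subst hyx
          rw [List.count_eq_zero_of_not_mem (by simp), List.count_eq_zero_of_not_mem (by simp)]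
          exact hr.refl _
        · unfold del
          rw [List.count_filter (by simpa using hyx), List.count_filter (by simpa using hyx)]
          exact h y
    exact hr.trans (hr.to_front hc (x := x)) (hr.trans (hr.app (h x) hd)
      (hr.symm (hr.to_front hc (x := x))))
  · push Not at hx
    rw [List.eq_nil_iff_forall_not_mem.2 fun x => (hx x).1,
      List.eq_nil_iff_forall_not_mem.2 fun x => (hx x).2]
    exact hr.refl _

end WordCong

lemma flatMap_subst {s : ℕ} {a b c : List ℕ} (ha : s ∉ a) (hb : s ∉ b) :
    (a ++ s :: b).flatMap (fun k => if k = s then c else [k]) = a ++ c ++ b := by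
  have key : ∀ l : List ℕ, s ∉ l → l.flatMap (fun k => if k = s then c else [k]) = l :=
    fun l hl => flatMap_eq_self fun k hk => by
      have : k ≠ s := fun e => hl (e ▸ hk)
      simp [this]
  rw [List.flatMap_append, List.flatMap_cons, key a ha, key b hb]
  simp

lemma nodup_middle_notMem {t x : ℕ} {a b : List ℕ} (htx : t ≠ x)
    (h : (del x (a ++ t :: b)).Nodup) : t ∉ a ∧ t ∉ b := by
  rw [del_append, del_cons_ne htx, List.nodup_middle, List.nodup_cons] at h
  simp only [List.mem_append, mem_del] at h
  tauto

lemma del_nodup {t : ℕ} {l : List ℕ} (h : l.Nodup) : (del t l).Nodup := h.filter _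

/-- Two words with the same letters other than `x` and no factor `xx` first differ by the position
of a letter `x`. -/
lemma first_difference {x : ℕ} {p v : List ℕ} (hpv : p ≠ v) (hd : del x p = del x v)
    (hp : Sparse (· = x) p) (hv : Sparse (· = x) v) :
    (∃ c t d e, t ≠ x ∧ p = c ++ x :: t :: d ∧ v = c ++ t :: e) ∨
    (∃ c t d e, t ≠ x ∧ v = c ++ x :: t :: d ∧ p = c ++ t :: e) ∨
    p = v ++ [x] ∨ v = p ++ [x] := by
  have aux : ∀ {p v : List ℕ} {z}, Sparse (· = x) (x :: p) → z ≠ x →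
      del x p = del x (z :: v) → ∃ d, p = z :: d := by
    intro p v z hs hz hd
    rw [del_cons_ne hz] at hd
    cases p with
    | nil => simp at hd
    | cons w p =>
      have hw : w ≠ x := by rintro rfl; simp at hs
      rw [del_cons_ne hw] at hd
      exact ⟨p, by rw [(List.cons.inj hd).1]⟩
  have aux2 : ∀ {p : List ℕ} {z}, Sparse (· = x) (z :: p) → [] = del x (z :: p) →
      z :: p = [x] := by
    intro p z hs hd
    have hz : z = x := by
      by_contra hz; rw [del_cons_ne hz] at hd; simp at hd
    subst hz
    rw [del_cons_self] at hd
    cases p with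
    | nil => rfl
    | cons w p =>
      have hw : w ≠ z := by rintro rfl; simp at hs
      rw [del_cons_ne hw] at hd; simp at hd
  induction p generalizing v with
  | nil =>
    cases v with
    | nil => exact absurd rfl hpv
    | cons z v => exact .inr (.inr (.inr (aux2 hv hd)))
  | cons y p ih =>
    cases v with
    | nil => exact .inr (.inr (.inl (aux2 hp hd.symm)))
    | cons z v =>
      by_cases hyz : y = z
      · subst hyz
        have hd' : del x p = del x v := by
          by_cases hy : y = x
          · subst hy; simpa using hd
          · rw [del_cons_ne hy, del_cons_ne hy] at hd; exact (List.cons.inj hd).2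
        rcases ih (fun e => hpv (by rw [e])) hd' hp.tail hv.tail with
          ⟨c, t, d, e, h1, rfl, rfl⟩ | ⟨c, t, d, e, h1, rfl, rfl⟩ | rfl | rfl
        · exact .inl ⟨y :: c, t, d, e, h1, rfl, rfl⟩
        · exact .inr (.inl ⟨y :: c, t, d, e, h1, rfl, rfl⟩)
        · exact .inr (.inr (.inl rfl))
        · exact .inr (.inr (.inr rfl))
      · by_cases hy : y = x
        · subst hy
          rw [del_cons_self] at hd
          obtain ⟨d, rfl⟩ := aux hp (Ne.symm hyz) hd
          exact .inl ⟨[], z, d, v, Ne.symm hyz, rfl, rfl⟩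
        · by_cases hz : z = x
          · subst hz
            rw [del_cons_self] at hd
            obtain ⟨d, rfl⟩ := aux hv hyz hd.symm
            exact .inr (.inl ⟨[], y, d, p, hyz, rfl, rfl⟩)
          · rw [del_cons_ne hy, del_cons_ne hz] at hd
            exact absurd (List.cons.inj hd).1 hyz

lemma sparse_join {D : ℕ → Prop} {t : ℕ} {a b : List ℕ} (ht : ¬ D t)
    (h1 : Sparse D (a ++ [t])) (h2 : Sparse D b) : Sparse D (a ++ t :: b) :=
  sparse_split.2 ⟨h1, sparse_cons_of_not ht h2⟩

namespace WordCong

variable {r : List ℕ → List ℕ → Prop} (hr : WordCong r) {x y z t : ℕ} {p u v w l m : List ℕ}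
include hr

/-- Reinserting a letter into a word whose letter `x` can be made a square. -/
lemma square_of_del (htx : t ≠ x) (htw : t ∈ w) (hw : (del x w).Nodup)
    (hs : Sparse (· = x) (del t w)) (h : r (del t w) (x :: x :: del x (del t w))) :
    r w (x :: x :: del x w) := by
  obtain ⟨a, b, rfl⟩ := List.append_of_mem htw
  obtain ⟨ha, hb⟩ := nodup_middle_notMem htx hw
  rw [del_append, del_cons_self, del_of_notMem ha, del_of_notMem hb] at hs h
  have subst : ∀ s a' b' c, s ≠ x → a ++ b = a' ++ s :: b' →
      r (a' ++ c ++ b') (x :: x :: (del x a' ++ c ++ del x b')) := by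
    intro s a' b' c hsx hab
    have hnd : (del x (a' ++ s :: b')).Nodup := by
      rw [← hab]
      rw [del_append] at hw ⊢
      rw [del_cons_ne htx, List.nodup_middle] at hw
      exact (List.nodup_cons.1 hw).2
    obtain ⟨hsa, hsb⟩ := nodup_middle_notMem hsx hnd
    rw [hab] at h
    have h' := hr.sub (fun k => if k = s then c else [k]) h
    rw [flatMap_subst hsa hsb, del_append, del_cons_ne hsx] at h'
    simp only [List.flatMap_cons, Ne.symm hsx, if_false] at h'
    rw [flatMap_subst (by simp [hsa]) (by simp [hsb])] at h'
    simpa using h'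
  rcases List.eq_nil_or_concat' a with rfl | ⟨a, s, rfl⟩
  · rw [List.nil_append, del_cons_ne htx]
    exact hr.trans (hr.consL h) (by simpa using hr.move_sq (x := x) (l := [t]) (m := del x b))
  · by_cases hsx : s = x
    · subst hsx
      cases b with
      | nil =>
        have := hr.appR (l := [t]) h
        simpa [del_cons_ne htx] using this
      | cons s' b =>
        have hs' : s' ≠ s := by
          rintro rfl
          simp only [List.append_assoc, List.cons_append, List.nil_append] at hs
          exact not_sparse_of_adjacent (D := (· = s')) rfl rfl hs
        have := subst s' (a ++ [s]) b [t, s'] hs' (by simp)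
        simpa [del_cons_ne htx, del_cons_ne hs'] using this
    · have := subst s a b [s, t] hsx (by simp)
      simpa [del_cons_ne htx, del_cons_ne hsx] using this

/-- A nontrivial identity between words with a single repeated letter turns it into a square. -/
lemma square_of_ne (hc : ¬ Commutes r) (h : r p v) (hpv : p ≠ v) (hd : del x p = del x v)
    (hnd : (del x p).Nodup) (hp : Sparse (· = x) p) (hv : Sparse (· = x) v) :
    r p (x :: x :: del x p) := by
  induction hn : p.length + v.length using Nat.strong_induction_on generalizing p v with
  | _ n ih =>
  subst hn
  have step : ∀ {p' v' : List ℕ} (t), r p' v' → p'.length + v'.length = p.length + v.length →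
      del x p' = del x v' → (del x p').Nodup → t ≠ x → t ∈ p' → del t p' ≠ del t v' →
      Sparse (· = x) (del t v') → r p' (x :: x :: del x p') := by
    intro p' v' t h' hlen hd' hnd' htx htp hne hsv
    have htv : t ∈ v' := by
      have : t ∈ del x v' := by rw [← hd']; simp [htp, htx]
      exact (mem_del.1 this).1
    have hdd : del x (del t p') = del x (del t v') := by
      rw [del_comm, hd', del_comm]
    have lt : ∀ w : List ℕ, t ∈ w → (del t w).length < w.length := fun w hw => by
      unfold _root_.del
      rw [List.length_filter_lt_length_iff_exists]
      exact ⟨t, hw, by simp⟩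
    have hndd : (del x (del t p')).Nodup := by
      rw [del_comm]; exact del_nodup hnd'
    by_cases hsp : Sparse (· = x) (del t p')
    · exact hr.square_of_del htx htp hnd' hsp
        (ih _ (by have := lt _ htp; have := lt _ htv; omega) (hr.erase h') hne hdd hndd hsp hsv rfl)
    · obtain ⟨l₁, e, f, l₂, h1, rfl, rfl⟩ := exists_of_not_sparse hsp
      have hb : r (del t p') (f :: f :: del f (del t p')) := by
        rw [h1]
        simpa using hr.absorb_block l₁ [] l₂ f (by simp)
      rw [hdd] at hb
      have := hr.square_of_del htx htv (hd' ▸ hnd') hsv (hr.trans (hr.symm (hr.erase h')) hb)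
      rw [hd']
      exact hr.trans h' this
  have stepA : ∀ {p' v' : List ℕ} (c t d e), r p' v' → p'.length + v'.length = p.length + v.length →
      del x p' = del x v' → (del x p').Nodup → t ≠ x → p' = c ++ x :: t :: d → v' = c ++ t :: e →
      Sparse (· = x) p' → Sparse (· = x) v' → r p' (x :: x :: del x p') := by
    intro p' v' c t d e h' hlen hd' hnd' htx hp' hv' hsp hsv
    have hndv : (del x v').Nodup := hd' ▸ hnd'
    obtain ⟨htc, hte⟩ := nodup_middle_notMem htx (hv' ▸ hndv)
    have htd : t ∉ d := (nodup_middle_notMem (a := c ++ [x]) htx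
      (by rw [hp'] at hnd'; simpa using hnd')).2
    have hEp : del t p' = c ++ x :: d := by
      rw [hp']; simp [del_cons_ne (Ne.symm htx), del_of_notMem htc, del_of_notMem htd]
    have hEv : del t v' = c ++ e := by
      rw [hv']; simp [del_of_notMem htc, del_of_notMem hte]
    have hcx : Sparse (· = x) (c ++ [x]) := (sparse_split.1 (hp' ▸ hsp)).1
    have hd1 : Sparse (· = x) (x :: t :: d) := (sparse_split.1 (hp' ▸ hsp)).2
    have hte' : Sparse (· = x) (t :: e) := (sparse_split.1 (hv' ▸ hsv)).2
    by_cases hne : del t p' = del t v'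
    · rw [hEp, hEv] at hne
      have he := List.append_cancel_left hne
      subst he
      rcases List.eq_nil_or_concat' c with rfl | ⟨c, s, rfl⟩
      · cases d with
        | nil =>
          subst hp' hv'
          exact absurd (hr.commutes_of_pair (Ne.symm htx) h') hc
        | cons s d =>
          have hsx : s ≠ x := by
            rintro rfl; simp at hte'
          have hst : s ≠ t := by rintro rfl; simp at htd
          have hsd : s ∉ d :=
            (nodup_middle_notMem (a := [x, t]) hsx (by rw [hp'] at hnd'; simpa using hnd')).2
          have e1 : del s p' = x :: t :: d := by
            rw [hp']; simp [del_cons_ne (Ne.symm hsx), del_cons_ne (Ne.symm hst), del_of_notMem hsd]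
          have e2 : del s v' = t :: x :: d := by
            rw [hv']; simp [del_cons_ne (Ne.symm hsx), del_cons_ne (Ne.symm hst), del_of_notMem hsd]
          have hsp1 : Sparse (· = x) (del s p') := by
            rw [e1, sparse_cons_cons]
            exact ⟨fun h => htx h.2, sparse_cons_of_not htx hd1.tail.tail.tail⟩
          -- the roles of the two words are exchanged
          have := step s (hr.symm h') (by omega) hd'.symm hndv hsx (by rw [hv']; simp)
            (by rw [e1, e2]; simp [htx]) hsp1
          rw [hd']; exact hr.trans h' this
      · have hsx : s ≠ x := by
          rintro rfl
          exact not_sparse_of_adjacent (D := (· = s)) (l₁ := c) (l₂ := []) rfl rfl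
            (by simpa using hcx)
        have hst : s ≠ t := by rintro rfl; simp at htc
        have hs := nodup_middle_notMem (a := c) (b := t :: x :: d) hsx (by
          rw [hv'] at hndv; simpa using hndv)
        have hsd : s ∉ d := fun h => hs.2 (by simp [h])
        have e1 : del s p' = c ++ x :: t :: d := by
          rw [hp']; simp [del_cons_ne (Ne.symm hsx), del_cons_ne (Ne.symm hst), del_of_notMem hsd,
            del_of_notMem hs.1]
        have e2 : del s v' = c ++ t :: x :: d := by
          rw [hv']; simp [del_cons_ne (Ne.symm hsx), del_cons_ne (Ne.symm hst), del_of_notMem hsd,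
            del_of_notMem hs.1]
        refine step s h' hlen hd' hnd' hsx (by rw [hp']; simp)
          (by rw [e1, e2]; simp [Ne.symm htx]) ?_
        rw [e2]
        exact sparse_join htx (sparse_concat_of_not htx hcx.left.left) hte'.tail
    · refine step t h' hlen hd' hnd' htx (by rw [hp']; simp) hne ?_
      rw [hEv]
      refine List.IsChain.append (Sparse.left hcx) hte'.tail ?_
      intro a ha b hb
      rcases List.eq_nil_or_concat' c with rfl | ⟨c, s, rfl⟩
      · simp at ha
      · simp at ha; subst ha
        rintro ⟨rfl, -⟩
        exact not_sparse_of_adjacent (D := (· = s)) (l₁ := c) (l₂ := []) rfl rfl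
          (by simpa using hcx)
  have stepB : ∀ {p' v' : List ℕ}, r p' v' → p'.length + v'.length = p.length + v.length →
      del x p' = del x v' → (del x p').Nodup → p' = v' ++ [x] →
      Sparse (· = x) p' → r p' (x :: x :: del x p') := by
    intro p' v' h' hlen hd' hnd' hp' hsp
    rcases List.eq_nil_or_concat' v' with rfl | ⟨c, s, rfl⟩
    · subst hp'
      exact absurd (hr.commutes_of_idem (hr.idem_of_trivial (hr.symm h') 0)) hc
    · have hsx : s ≠ x := by
        rintro rfl
        rw [hp'] at hsp
        exact not_sparse_of_adjacent (D := (· = s)) (l₁ := c) (l₂ := []) rfl rfl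
          (by simpa using hsp)
      have hs := (nodup_middle_notMem (a := c) (b := []) hsx (by rw [← hd']; exact hnd')).1
      refine step s h' hlen hd' hnd' hsx (by rw [hp']; simp) ?_ ?_
      · rw [hp']; simp [del_cons_ne (Ne.symm hsx)]
      · rw [hp'] at hsp
        simpa [del_of_notMem hs] using hsp.left.left
  rcases first_difference hpv hd hp hv with
    ⟨c, t, d, e, h1, h2, h3⟩ | ⟨c, t, d, e, h1, h2, h3⟩ | h2 | h2
  · exact stepA c t d e h rfl hd hnd h1 h2 h3 hp hv
  · rw [hd]
    exact hr.trans h (stepA c t d e (hr.symm h) (by omega) hd.symm (hd ▸ hnd) h1 h2 h3 hv hp)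
  · exact stepB h rfl hd hnd h2 hp
  · rw [hd]
    exact hr.trans h (stepB (hr.symm h) (by omega) hd.symm (hd ▸ hnd) h2 hv)

end WordCong

/-- `Crit p q`: every fully invariant congruence of our kind that moves `p` at all identifies `p`
with `q`. -/
def Crit (p q : List ℕ) : Prop :=
  ∀ r : List ℕ → List ℕ → Prop, WordCong r → ∀ v, r p v → v = p ∨ r p q

section Fill

variable {D : ℕ → Prop} {K : ℕ → Bool} {w : List ℕ}

/-- A word is obtained from a sparse restriction of it by a substitution fixing the letters in `D`,
up to a prefix and a suffix. -/
lemma exists_substitution (hs : Sparse D (w.filter K))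
    (hc : ∀ c, ¬ D c → (w.filter K).count c ≤ 1) :
    ∃ (σ : ℕ → List ℕ) (A B : List ℕ), (∀ d, D d → σ d = [d]) ∧
      w = A ++ (w.filter K).flatMap σ ++ B ∧ ((∀ c ∈ (w.filter K).head?, ¬ D c) → A = []) := by
  classical
  have upd : ∀ (σ : ℕ → List ℕ) (c : ℕ) (l P : List ℕ), c ∉ P →
      P.flatMap (Function.update σ c l) = P.flatMap σ := fun σ c l P hcP =>
    flatMap_congr_mem fun b hb => Function.update_of_ne (by rintro rfl; exact hcP hb) _ _
  have updD : ∀ (σ : ℕ → List ℕ) (c : ℕ) (l : List ℕ), ¬ D c → (∀ d, D d → σ d = [d]) →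
      ∀ d, D d → Function.update σ c l d = [d] := fun σ c l hcD h d hd => by
    rw [Function.update_of_ne (by rintro rfl; exact hcD hd), h d hd]
  induction w with
  | nil => exact ⟨fun a => [a], [], [], by simp⟩
  | cons a w ih =>
    by_cases ha : K a
    · rw [List.filter_cons_of_pos ha] at hs hc ⊢
      obtain ⟨σ, A, B, h1, h2, h3⟩ := ih hs.tail fun c hcD =>
        (List.count_le_count_cons).trans (hc c hcD)
      by_cases hD : D a
      · have hA : A = [] := h3 fun c hcP => by
          cases hP : w.filter K with
          | nil => simp [hP] at hcP
          | cons b P =>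
            simp only [hP, List.head?_cons, Option.mem_some_iff] at hcP
            subst hcP
            rw [hP, sparse_cons_cons] at hs
            exact fun h => hs.1 ⟨hD, h⟩
        subst hA
        refine ⟨σ, [], B, h1, ?_, fun _ => rfl⟩
        simp only [List.flatMap_cons, h1 a hD, List.nil_append, List.cons_append]
        rw [List.nil_append] at h2
        rw [← h2]
      · have haP : a ∉ w.filter K := fun h => by
          have := hc a hD
          rw [List.count_cons_self] at this
          have := List.count_pos_iff.2 h
          omega
        refine ⟨Function.update σ a (a :: A), [], B, updD _ _ _ hD h1, ?_, fun _ => rfl⟩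
        rw [List.flatMap_cons, upd _ _ _ _ haP, Function.update_self]
        simpa using h2
    · rw [List.filter_cons_of_neg ha] at hs hc ⊢
      obtain ⟨σ, A, B, h1, h2, h3⟩ := ih hs hc
      cases hP : w.filter K with
      | nil => exact ⟨σ, [], a :: w, h1, by simp⟩
      | cons b P =>
        by_cases hD : D b
        · refine ⟨σ, a :: A, B, h1, ?_, fun h => absurd hD (h b (by simp))⟩
          rw [hP] at h2
          simpa using h2
        · have hbP : b ∉ P := fun h => by
            have := hc b hD
            rw [hP, List.count_cons_self] at this
            have := List.count_pos_iff.2 h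
            omega
          refine ⟨Function.update σ b (a :: (A ++ σ b)), [], B, updD _ _ _ hD h1, ?_, fun _ => rfl⟩
          rw [List.flatMap_cons, upd _ _ _ _ hbP, Function.update_self]
          rw [hP] at h2
          simpa using h2

lemma exists_substitution_right {d : ℕ} (hd : D d)
    (hs : Sparse D (d :: w.filter K)) (hc : ∀ c, ¬ D c → (w.filter K).count c ≤ 1) :
    ∃ (σ : ℕ → List ℕ) (B : List ℕ), (∀ d, D d → σ d = [d]) ∧
      w = (w.filter K).flatMap σ ++ B := by
  obtain ⟨σ, A, B, h1, h2, h3⟩ := exists_substitution hs.tail hc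
  obtain rfl : A = [] := h3 fun c hcP => by
    cases hP : w.filter K with
    | nil => simp [hP] at hcP
    | cons b P =>
      simp only [hP, List.head?_cons, Option.mem_some_iff] at hcP
      subst hcP
      rw [hP, sparse_cons_cons] at hs
      exact fun h => hs.1 ⟨hd, h⟩
  exact ⟨σ, B, h1, h2⟩

lemma exists_substitution_left {d : ℕ} (hd : D d)
    (hs : Sparse D (w.filter K ++ [d])) (hc : ∀ c, ¬ D c → (w.filter K).count c ≤ 1) :
    ∃ (σ : ℕ → List ℕ) (A : List ℕ), (∀ d, D d → σ d = [d]) ∧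
      w = A ++ (w.filter K).flatMap σ := by
  obtain ⟨σ, B, h1, h2⟩ := exists_substitution_right (w := w.reverse) hd
    (by simpa using hs.reverse) (by simpa using hc)
  refine ⟨fun c => (σ c).reverse, B.reverse, fun c hcD => by simp [h1 c hcD], ?_⟩
  have := congrArg List.reverse h2
  rw [List.reverse_append, List.reverse_flatMap, List.filter_reverse, List.reverse_reverse,
    List.reverse_reverse] at this
  exact this

end Fill

namespace WordCong

variable {r : List ℕ → List ℕ → Prop} (hr : WordCong r) {x a b : ℕ} {w : List ℕ} {K : ℕ → Bool}
include hr

lemma square_of_filter (hs : Sparse (· = x) (w.filter K))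
    (hc : (del x (w.filter K)).Nodup) (h : r (w.filter K) (x :: x :: del x (w.filter K))) :
    r w (x :: x :: del x w) := by
  obtain ⟨σ, A, B, h1, h2, -⟩ := exists_substitution (D := (· = x)) hs
    (fun c hcx => by
      have := List.nodup_iff_count_le_one.1 hc c
      rwa [del, List.count_filter (by simpa using hcx)] at this)
  have h3 := hr.appR (l := B) (hr.appL (l := A) (hr.sub σ h))
  rw [← h2] at h3
  simp only [List.flatMap_cons, h1 x rfl, List.append_assoc,
    List.cons_append] at h3
  have h4 := hr.absorb_of_sq (hr.trans h3 hr.move_sq)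
  have e : del x w = del x (A ++ ((del x (w.filter K)).flatMap σ ++ B)) := by
    conv_lhs => rw [h2]
    simp only [del_append]
    rw [filter_flatMap_ne σ (h1 x rfl), List.append_assoc]
  rwa [e]

lemma swap_of_filter {c s : List ℕ} (h1 : Sparse (fun y => y = a ∨ y = b) (c.filter K ++ [b]))
    (h2 : Sparse (fun y => y = a ∨ y = b) (a :: s.filter K))
    (hc : ∀ y, y ≠ a → y ≠ b → (c.filter K ++ s.filter K).count y ≤ 1)
    (h : r (c.filter K ++ b :: a :: s.filter K) (c.filter K ++ a :: b :: s.filter K)) :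
    r (c ++ b :: a :: s) (c ++ a :: b :: s) := by
  have hc' : ∀ y, ¬ (y = a ∨ y = b) → (c.filter K).count y + (s.filter K).count y ≤ 1 := by
    intro y hy
    rw [← List.count_append]
    exact hc y (fun e => hy (Or.inl e)) fun e => hy (Or.inr e)
  obtain ⟨σ, A, e1, e2⟩ := exists_substitution_left (Or.inr rfl) h1
    fun y hy => (Nat.le_add_right _ _).trans (hc' y hy)
  obtain ⟨τ, B, f1, f2⟩ := exists_substitution_right (Or.inl rfl) h2
    fun y hy => (Nat.le_add_left _ _).trans (hc' y hy)
  let ρ : ℕ → List ℕ := fun y => if y ∈ c.filter K then σ y else τ y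
  have ρD : ∀ y, y = a ∨ y = b → ρ y = [y] := fun y hy => by
    simp only [ρ]; split
    · exact e1 y hy
    · exact f1 y hy
  have hρ1 : (c.filter K).flatMap ρ = (c.filter K).flatMap σ :=
    flatMap_congr_mem fun y hy => by simp only [ρ, if_pos hy]
  have hρ2 : (s.filter K).flatMap ρ = (s.filter K).flatMap τ :=
    flatMap_congr_mem fun y hy => by
      by_cases hD : y = a ∨ y = b
      · rw [ρD y hD, f1 y hD]
      · have hyc : y ∉ c.filter K := fun hyc => by
          have := hc' y hD
          have := List.count_pos_iff.2 hy
          have := List.count_pos_iff.2 hyc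
          omega
        simp only [ρ, if_neg hyc]
  have h3 := hr.appR (l := B) (hr.appL (l := A) (hr.sub ρ h))
  simp only [List.flatMap_append, List.flatMap_cons, ρD a (Or.inl rfl), ρD b (Or.inr rfl), hρ1,
    hρ2, List.singleton_append] at h3
  rw [e2, f2]
  simpa using h3

end WordCong

lemma crit_square {p : List ℕ} {x : ℕ} (hnd : (del x p).Nodup) (hs : Sparse (· = x) p)
    (hx : 2 ≤ p.count x) : Crit p (x :: x :: del x p) := by
  intro r hr v h
  by_cases hc : Commutes r
  · right
    refine hr.of_count hc fun y => ?_
    by_cases hy : y = x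
    · subst hy
      have h0 : (del y p).count y = 0 := List.count_eq_zero.2 (by simp)
      obtain ⟨n, hn⟩ := Nat.exists_eq_add_of_le' hx
      rw [hn, List.count_cons_self, List.count_cons_self, h0]
      exact hr.replicate_two n
    · rw [List.count_cons_of_ne (Ne.symm hy), List.count_cons_of_ne (Ne.symm hy), del,
        List.count_filter (by simpa using hy)]
      exact hr.refl _
  · have hd := hr.eq_of_nodup hc (hr.erase h) hnd
    by_cases hv : Sparse (· = x) v
    · by_cases e : v = p
      · exact Or.inl e
      · exact Or.inr (hr.square_of_ne hc h (Ne.symm e) hd hnd hs hv)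
    · right
      obtain ⟨l₁, e, f, l₂, rfl, rfl, rfl⟩ := exists_of_not_sparse hv
      rw [hd]
      refine hr.trans h ?_
      simpa using hr.absorb_block l₁ [] l₂ f (by simp)

section Pair

variable {a b : ℕ} {l p v p₁ p₂ : List ℕ}

lemma Sparse.concat_swap {D : ℕ → Prop} (ha : D a) (h : Sparse D (l ++ [a])) :
    Sparse D (l ++ [b]) := by
  rcases List.eq_nil_or_concat' l with rfl | ⟨l, c, rfl⟩
  · simp
  · simp only [List.append_assoc, List.cons_append, List.nil_append, sparse_append_cons_cons] at h ⊢
    exact ⟨h.1, fun h' => h.2.1 ⟨h'.1, ha⟩, by simp⟩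

lemma Sparse.cons_swap {D : ℕ → Prop} (ha : D a) (h : Sparse D (a :: l)) : Sparse D (b :: l) := by
  cases l with
  | nil => simp
  | cons c l =>
    rw [sparse_cons_cons] at h ⊢
    exact ⟨fun h' => h.1 ⟨ha, h'.2⟩, h.2⟩

lemma Sparse.del_right (h : Sparse (fun y => y = a ∨ y = b) l) : Sparse (· = a) (del b l) := by
  induction l with
  | nil => simp
  | cons c l ih =>
    have ih := ih h.tail
    by_cases hcb : c = b
    · subst hcb; simpa using ih
    · rw [del_cons_ne hcb]
      by_cases hca : c = a
      · cases l with
        | nil => simp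
        | cons e l =>
          rw [sparse_cons_cons] at h
          have he : ¬ (e = a ∨ e = b) := fun he => h.1 ⟨Or.inl hca, he⟩
          rw [del_cons_ne fun e1 => he (Or.inr e1)] at ih ⊢
          exact sparse_cons_cons.2 ⟨fun h' => he (Or.inl h'.2), ih⟩
      · exact sparse_cons_of_not hca ih

lemma eq_nil_of_del (hab : a ≠ b) (ha : del a v = []) (hb : del b v = []) : v = [] := by
  cases v with
  | nil => rfl
  | cons c v =>
    by_cases h : c = a
    · subst h; rw [del_cons_ne hab] at hb; simp at hb
    · rw [del_cons_ne h] at ha; simp at ha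

lemma eq_right_of_del_cons {e : ℕ} (ha : del a (a :: p) = del a (e :: v))
    (hb : del b (a :: p) = del b (e :: v)) (hne : e ≠ a) (hab : a ≠ b) :
    e = b ∧ del a p = b :: del a v := by
  have he : e = b := by
    by_contra h
    rw [del_cons_ne hab, del_cons_ne h] at hb
    exact hne (List.cons.inj hb).1.symm
  subst he
  rw [del_cons_self, del_cons_ne hne] at ha
  exact ⟨rfl, ha⟩

/-- Words with the same restrictions have the same first letter, unless one of them starts with
two of the erased letters. -/
lemma head_eq_of_del {c e : ℕ} (hab : a ≠ b)
    (hs : (c = a ∨ c = b) → ∀ f ∈ p.head?, ¬ (f = a ∨ f = b))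
    (ha : del a (c :: p) = del a (e :: v)) (hb : del b (c :: p) = del b (e :: v)) : e = c := by
  by_contra hne
  by_cases hca : c = a
  · subst hca
    obtain ⟨rfl, h⟩ := eq_right_of_del_cons ha hb hne hab
    cases p with
    | nil => simp at h
    | cons f p =>
      have hf := hs (Or.inl rfl) f (by simp)
      rw [del_cons_ne fun h => hf (Or.inl h)] at h
      exact hf (Or.inr (List.cons.inj h).1)
  · by_cases hcb : c = b
    · subst hcb
      obtain ⟨rfl, h⟩ := eq_right_of_del_cons hb ha hne hab.symm
      cases p with
      | nil => simp at h
      | cons f p =>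
        have hf := hs (Or.inr rfl) f (by simp)
        rw [del_cons_ne fun h => hf (Or.inr h)] at h
        exact hf (Or.inl (List.cons.inj h).1)
    · rw [del_cons_ne hca] at ha
      rw [del_cons_ne hcb] at hb
      by_cases hea : e = a
      · rw [del_cons_ne (hea ▸ hab)] at hb
        exact hne (List.cons.inj hb).1.symm
      · rw [del_cons_ne hea] at ha
        exact hne (List.cons.inj ha).1.symm

lemma eq_of_del_cons {c : ℕ} (h : del a (c :: p) = del a (c :: v)) : del a p = del a v := by
  by_cases hc : c = a
  · subst hc; simpa using h
  · simpa [del_cons_ne hc] using h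

lemma ne_nil_of_del {c : ℕ} (hab : a ≠ b) (ha : del a (c :: p) = del a v)
    (hb : del b (c :: p) = del b v) : ∃ e v', v = e :: v' := by
  cases v with
  | nil => exact absurd (eq_nil_of_del hab ha hb) (by simp)
  | cons e v => exact ⟨e, v, rfl⟩

lemma eq_of_del (hab : a ≠ b) (hs : Sparse (fun y => y = a ∨ y = b) p)
    (ha : del a p = del a v) (hb : del b p = del b v) : v = p := by
  induction p generalizing v with
  | nil => exact eq_nil_of_del hab ha.symm hb.symm
  | cons c p ih =>
    obtain ⟨e, v, rfl⟩ := ne_nil_of_del hab ha hb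
    obtain rfl : e = c := by
      refine head_eq_of_del hab (fun hc f hf hfD => ?_) ha hb
      cases p with
      | nil => simp at hf
      | cons g p =>
        obtain rfl : g = f := by simpa using hf
        exact (sparse_cons_cons.1 hs).1 ⟨hc, hfD⟩
    rw [ih hs.tail (eq_of_del_cons ha) (eq_of_del_cons hb)]

lemma eq_or_eq_of_del (hab : a ≠ b) (hs₁ : Sparse (fun y => y = a ∨ y = b) (p₁ ++ [b]))
    (hs₂ : Sparse (fun y => y = a ∨ y = b) (a :: p₂))
    (ha : del a (p₁ ++ b :: a :: p₂) = del a v) (hb : del b (p₁ ++ b :: a :: p₂) = del b v) :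
    v = p₁ ++ b :: a :: p₂ ∨ v = p₁ ++ a :: b :: p₂ := by
  induction p₁ generalizing v with
  | nil =>
    rw [List.nil_append] at ha hb
    obtain ⟨e, v, rfl⟩ := ne_nil_of_del hab ha hb
    by_cases he : e = b
    · subst he
      exact Or.inl (by rw [eq_of_del hab hs₂ (eq_of_del_cons ha) (eq_of_del_cons hb)]; rfl)
    · obtain ⟨rfl, h⟩ := eq_right_of_del_cons hb ha he hab.symm
      rw [del_cons_ne he] at h
      replace h := (List.cons.inj h).2
      obtain ⟨f, v, rfl⟩ : ∃ f v', v = f :: v' := by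
        cases v with
        | nil => simp [del_cons_ne (Ne.symm he)] at ha
        | cons f v => exact ⟨f, v, rfl⟩
      rw [del_cons_ne (Ne.symm he), del_cons_self, del_cons_self] at ha
      obtain rfl : f = b := by
        by_contra hf
        rw [del_cons_ne hf] at h
        cases p₂ with
        | nil => simp at h
        | cons g p₂ =>
          have hg := fun h' => (sparse_cons_cons.1 hs₂).1 ⟨Or.inl rfl, h'⟩
          rw [del_cons_ne fun h => hg (Or.inr h)] at h
          rw [del_cons_ne fun h => hg (Or.inl h)] at ha
          have hfe : f = e := by
            by_contra hfe
            rw [del_cons_ne hfe] at ha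
            exact hf (List.cons.inj ha).1.symm
          exact hg (Or.inl ((List.cons.inj h).1.trans hfe))
      rw [del_cons_ne (Ne.symm hab)] at ha
      rw [del_cons_self] at h
      right
      rw [eq_of_del hab hs₂.tail (List.cons.inj ha).2 h]
      rfl
  | cons c p₁ ih =>
    rw [List.cons_append] at ha hb hs₁
    obtain ⟨e, v, rfl⟩ := ne_nil_of_del hab ha hb
    obtain rfl : e = c := by
      refine head_eq_of_del hab (fun hc f hf hfD => ?_) ha hb
      cases p₁ with
      | nil =>
        exact (sparse_cons_cons.1 hs₁).1 ⟨hc, Or.inr rfl⟩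
      | cons g p₁ =>
        obtain rfl : g = f := by simpa using hf
        exact (sparse_cons_cons.1 hs₁).1 ⟨hc, hfD⟩
    rcases ih hs₁.tail (eq_of_del_cons ha) (eq_of_del_cons hb) with rfl | rfl
    · exact Or.inl rfl
    · exact Or.inr rfl

end Pair

lemma crit_swap {a b : ℕ} {p₁ p₂ : List ℕ} (hab : a ≠ b)
    (hs₁ : Sparse (fun y => y = a ∨ y = b) (p₁ ++ [b]))
    (hs₂ : Sparse (fun y => y = a ∨ y = b) (a :: p₂))
    (hc : ∀ y, y ≠ a → y ≠ b → (p₁ ++ p₂).count y ≤ 1)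
    (ha : 2 ≤ (p₁ ++ b :: a :: p₂).count a) (hb : 2 ≤ (p₁ ++ b :: a :: p₂).count b) :
    Crit (p₁ ++ b :: a :: p₂) (p₁ ++ a :: b :: p₂) := by
  intro r hr v h
  by_cases hcm : Commutes r
  · right
    exact hr.appL (hr.pair_of_commutes hcm)
  have hc' : ∀ y, y ≠ a → y ≠ b → (p₁ ++ b :: a :: p₂).count y ≤ 1 := by
    intro y h1 h2
    simpa [List.count_append, Ne.symm h1, Ne.symm h2] using hc y h1 h2
  have key : ∀ {a b : ℕ} {p q : List ℕ}, a ≠ b → del b q = del b p → del a q = del a p →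
      Sparse (· = a) (del b p) → (∀ y, y ≠ a → y ≠ b → p.count y ≤ 1) → 2 ≤ p.count a → r p v →
      del b v = del b p ∨ r p q := by
    intro a b p q hab hqb hqa hs hc ha h
    have hnd : (del a (del b p)).Nodup := by
      rw [List.nodup_iff_count_le_one]
      intro y
      by_cases hy : y ≠ a ∧ y ≠ b
      · exact ((List.filter_sublist.trans List.filter_sublist).count_le y).trans (hc y hy.1 hy.2)
      · rw [List.count_eq_zero.2]
        · omega
        · simp only [mem_del]; tauto
    have ha' : 2 ≤ (del b p).count a := by
      rwa [del, List.count_filter (by simpa using hab)]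
    rcases crit_square hnd hs ha' r hr _ (hr.erase h) with h1 | h1
    · exact Or.inl h1
    · right
      have h2 := hr.square_of_filter hs hnd h1
      have h3 : r q (a :: a :: del a q) :=
        hr.square_of_filter (K := fun y => y ≠ b) (w := q) (by rw [← del, hqb]; exact hs)
          (by rw [← del, hqb]; exact hnd) (by rw [← del, hqb]; exact h1)
      rw [hqa] at h3
      exact hr.trans h2 (hr.symm h3)
  have hdb : del b (p₁ ++ a :: b :: p₂) = del b (p₁ ++ b :: a :: p₂) := by
    simp [del_cons_ne hab]
  have hda : del a (p₁ ++ a :: b :: p₂) = del a (p₁ ++ b :: a :: p₂) := by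
    simp [del_cons_ne (Ne.symm hab)]
  have hsa : Sparse (· = a) (del b (p₁ ++ b :: a :: p₂)) := by
    have h1 := (hs₁.concat_swap (b := a) (Or.inr rfl)).del_right
    have h2 := hs₂.del_right
    simp only [del_append, del_cons_self, del_cons_ne hab, del_nil] at h1 h2 ⊢
    exact sparse_split.2 ⟨h1, h2⟩
  have hsb : Sparse (· = b) (del a (p₁ ++ b :: a :: p₂)) := by
    simp only [or_comm (b := _ = b)] at hs₁ hs₂
    have h1 := hs₁.del_right
    have h2 := (hs₂.cons_swap (b := b) (Or.inr rfl)).del_right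
    simp only [del_append, del_cons_self, del_cons_ne (Ne.symm hab), del_nil] at h1 h2 ⊢
    exact sparse_split.2 ⟨h1, h2⟩
  rcases key hab hdb hda hsa hc' ha h with h1 | h1
  · rcases key hab.symm hda hdb hsb (fun y h1 h2 => hc' y h2 h1) hb h with h2 | h2
    · rcases eq_or_eq_of_del hab hs₁ hs₂ h2.symm h1.symm with h3 | rfl
      · exact Or.inl h3
      · exact Or.inr h
    · exact Or.inr h2
  · exact Or.inr h1

section CriticalLetters

lemma crit_nil (x : ℕ) : Crit [] [x] := by
  intro r hr v h
  cases v with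
  | nil => exact Or.inl rfl
  | cons c v =>
    right
    have h1 := hr.count_replicate h c
    rw [List.count_cons_self] at h1
    simpa using hr.sub (fun _ => [x]) (hr.trivial_of_replicate h1)

lemma crit_letter (x : ℕ) : Crit [x] [x, x] := by
  intro r hr v h
  by_cases hp : v.Perm [x]
  · exact Or.inl (List.perm_singleton.1 hp)
  · right
    rw [List.perm_iff_count] at hp
    push Not at hp
    obtain ⟨y, hy⟩ := hp
    exact hr.idem_of_count h (List.nodup_iff_count_le_one.1 (by simp) y) hy.symm x

lemma crit_pair {x y : ℕ} (hxy : x ≠ y) : Crit [x, y] [y, x] := by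
  intro r hr v h
  by_cases hc : Commutes r
  · exact Or.inr (hc [x] [y])
  · exact Or.inl (hr.eq_of_nodup hc h (by simpa using hxy)).symm

end CriticalLetters

namespace WordCong

section Replicate

variable {r : List ℕ → List ℕ → Prop} (hr : WordCong r) {x : ℕ} {w : List ℕ}
include hr

lemma replicate_idem (h : r [x] [x, x]) (n : ℕ) : r (List.replicate (n + 1) x) [x] := by
  induction n with
  | zero => exact hr.refl _
  | succ n ih => exact hr.trans (hr.consL ih) (hr.symm h)

lemma replicate_trivial (h : r [] [x]) (n : ℕ) : r (List.replicate n x) [] := by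
  induction n with
  | zero => exact hr.refl _
  | succ n ih => exact hr.trans (hr.consL ih) (hr.symm h)

lemma square_of_not_sparse
    (h : ¬ Sparse (· = x) (w.filter fun y => decide (w.count y = 1 ∨ y = x))) :
    r w (x :: x :: del x w) := by
  obtain ⟨l₁, e, f, l₂, h1, rfl, rfl⟩ := exists_of_not_sparse h
  obtain ⟨s₁, a, s₂, h2, h3⟩ := exists_of_filter_eq_append _ h1
  have h4 : ∀ y ∈ a, y ≠ f → 2 ≤ (s₁ ++ f :: (a ++ f :: s₂)).count y := by
    intro y hy _
    rw [← h2]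
    have h5 := h3 y hy
    simp only [decide_eq_true_eq] at h5
    have : 0 < w.count y := List.count_pos_iff.2 (by rw [h2]; simp [hy])
    omega
  have h5 := hr.absorb_block s₁ a s₂ f h4
  have e : del f w = del f (s₁ ++ a ++ s₂) := by
    rw [h2]; simp
  rw [← h2] at h5
  rwa [e]

end Replicate

section Transfer

variable {r d : List ℕ → List ℕ → Prop} {u v : List ℕ}

lemma le_of_crit_of_commutes (hr : WordCong r) (hd : WordCong d)
    (hcrit : ∀ p q, Crit p q → r p q → d p q) (hc : Commutes r) (h : r u v) : d u v := by
  have hdc : Commutes d :=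
    hd.commutes_of_pair zero_ne_one (hcrit _ _ (crit_pair zero_ne_one) (hc [0] [1]))
  have key : ∀ {u v : List ℕ} (x : ℕ), r u v → u.count x < v.count x →
      d (List.replicate (u.count x) x) (List.replicate (v.count x) x) := by
    intro u v x h hlt
    rcases Nat.lt_or_ge (u.count x) 2 with hu | hu
    · have h1 := hr.idem_of_count h (Nat.le_of_lt_succ hu) hlt.ne x
      rcases Nat.eq_zero_or_pos (u.count x) with h0 | h0
      · have h2 := hr.count_replicate h x
        obtain ⟨n, hn⟩ := Nat.exists_eq_add_of_lt hlt
        rw [hn, h0] at h2 ⊢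
        rw [zero_add] at h2 ⊢
        exact hd.symm (hd.replicate_trivial (hcrit _ _ (crit_nil x) (hr.trivial_of_replicate h2)) _)
      · have h2 := hd.replicate_idem (hcrit _ _ (crit_letter x) h1)
        obtain ⟨n, hn⟩ := Nat.exists_eq_add_of_le' (show 1 ≤ u.count x from h0)
        obtain ⟨m, hm⟩ := Nat.exists_eq_add_of_le' (show 1 ≤ v.count x by omega)
        rw [hn, hm]
        exact hd.trans (h2 n) (hd.symm (h2 m))
    · obtain ⟨n, hn⟩ := Nat.exists_eq_add_of_le' hu
      obtain ⟨m, hm⟩ := Nat.exists_eq_add_of_le' (show 2 ≤ v.count x by omega)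
      rw [hn, hm]
      exact hd.trans (hd.replicate_two n) (hd.symm (hd.replicate_two m))
  refine hd.of_count hdc fun x => ?_
  rcases lt_trichotomy (u.count x) (v.count x) with h1 | h1 | h1
  · exact key x h h1
  · rw [h1]; exact hd.refl _
  · exact hd.symm (key x (hr.symm h) h1)

lemma square_of_filter_ne (hr : WordCong r) (hd : WordCong d)
    (hcrit : ∀ p q, Crit p q → r p q → d p q) (h : r u v) {x : ℕ} (hx : 2 ≤ u.count x)
    (hne : ¬ (u.filter (fun y => decide (u.count y = 1 ∨ y = x)) =
        v.filter (fun y => decide (u.count y = 1 ∨ y = x)) ∧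
      Sparse (· = x) (u.filter fun y => decide (u.count y = 1 ∨ y = x)))) :
    d u (x :: x :: del x u) := by
  by_cases hs : Sparse (· = x) (u.filter fun y => decide (u.count y = 1 ∨ y = x))
  · have hnd : (del x (u.filter fun y => decide (u.count y = 1 ∨ y = x))).Nodup := by
      rw [List.nodup_iff_count_le_one]
      intro y
      by_cases hy : y ∈ del x (u.filter fun y => decide (u.count y = 1 ∨ y = x))
      · simp only [mem_del, List.mem_filter, decide_eq_true_eq] at hy
        refine ((List.filter_sublist.trans List.filter_sublist).count_le y).trans ?_
        rcases hy.1.2 with h | h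
        · exact h.le
        · exact absurd h hy.2
      · rw [List.count_eq_zero.2 hy]; omega
    refine hd.square_of_filter hs hnd (hcrit _ _ (crit_square hnd hs ?_) ?_)
    · rwa [List.count_filter (by simp)]
    · refine (crit_square hnd hs ?_ r hr _ (hr.restrict _ h)).resolve_left fun e => hne ⟨e.symm, hs⟩
      rwa [List.count_filter (by simp)]
  · exact hd.square_of_not_sparse hs

end Transfer

end WordCong

/-- The situation of two congruent words that cannot be told apart by restricting them to the
simple letters and one repeated letter. -/
structure Aligned (r : List ℕ → List ℕ → Prop) (S : ℕ → Bool) (w v : List ℕ) : Prop where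
  rel : r w v
  perm : w.Perm v
  simple : ∀ y, S y ↔ w.count y = 1
  filter_simple : w.filter S = v.filter S
  filter_eq : ∀ x, 2 ≤ w.count x → w.filter (fun y => decide (S y ∨ y = x)) =
    v.filter (fun y => decide (S y ∨ y = x))
  sparse : ∀ x, 2 ≤ w.count x → Sparse (· = x) (w.filter (fun y => decide (S y ∨ y = x)))

namespace Aligned

variable {r d : List ℕ → List ℕ → Prop} {S : ℕ → Bool} {w v : List ℕ} {a b x : ℕ}

lemma two_le (h : Aligned r S w v) (hx : x ∈ w) (hS : ¬ S x) : 2 ≤ w.count x := by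
  have h1 := List.count_pos_iff.2 hx
  have h2 := (h.simple x).not.1 hS
  omega

lemma exists_simple {l₁ m l₂ : List ℕ} (h : Aligned r S (l₁ ++ x :: (m ++ x :: l₂)) v) :
    ∃ y ∈ m, S y := by
  by_contra hm
  push Not at hm
  have hs := h.sparse x (by simp [List.count_append]; omega)
  simp only [List.filter_append, or_true, decide_true, List.filter_cons_of_pos] at hs
  cases hf : m.filter (fun y => decide (S y ∨ y = x)) with
  | nil =>
    rw [hf] at hs
    exact not_sparse_of_adjacent (D := (· = x)) rfl rfl hs
  | cons c m' =>
    have hc : c ∈ m.filter (fun y => decide (S y ∨ y = x)) := by rw [hf]; simp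
    simp only [List.mem_filter, decide_eq_true_eq] at hc
    have hcx : c = x := hc.2.resolve_left (hm c hc.1)
    rw [hf, hcx] at hs
    exact not_sparse_of_adjacent (D := (· = x)) rfl rfl hs

/-- A factor without simple letters between two letters. -/
lemma nodup_of_not_simple {l₁ m l₂ : List ℕ} (h : Aligned r S (l₁ ++ (m ++ l₂)) v)
    (hm : ∀ y ∈ m, ¬ S y) : m.Nodup ∧ ∀ y ∈ m, y ∈ l₁ ∨ y ∈ l₂ := by
  have hnd : m.Nodup := by
    rw [List.nodup_iff_count_le_one]
    intro y
    by_contra hy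
    obtain ⟨m₁, m', rfl⟩ := List.append_of_mem (List.count_pos_iff.1 (show 0 < m.count y by omega))
    have : y ∈ m₁ ∨ y ∈ m' := by
      by_contra hn
      push Not at hn
      simp [List.count_append, List.count_eq_zero.2 hn.1, List.count_eq_zero.2 hn.2] at hy
    rcases this with h1 | h1
    · obtain ⟨m₂, m₃, rfl⟩ := List.append_of_mem h1
      obtain ⟨z, hz, hSz⟩ := exists_simple (l₁ := l₁ ++ m₂) (m := m₃) (l₂ := m' ++ l₂) (x := y)
        (by simpa using h)
      exact hm z (by simp [hz]) hSz
    · obtain ⟨m₂, m₃, rfl⟩ := List.append_of_mem h1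
      obtain ⟨z, hz, hSz⟩ := exists_simple (l₁ := l₁ ++ m₁) (m := m₂) (l₂ := m₃ ++ l₂) (x := y)
        (by simpa using h)
      exact hm z (by simp [hz]) hSz
  refine ⟨hnd, fun y hy => ?_⟩
  by_contra hn
  push Not at hn
  have h2 := h.two_le (x := y) (by simp [hy]) (hm y hy)
  simp only [List.count_append, List.count_eq_zero.2 hn.1, List.count_eq_zero.2 hn.2] at h2
  have := List.nodup_iff_count_le_one.1 hnd y
  omega

end Aligned

namespace Aligned

variable {r d : List ℕ → List ℕ → Prop} {S : ℕ → Bool} {a b : ℕ} {c t s v : List ℕ}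

section Blocks

variable {p : List ℕ} (h : Aligned r S (p ++ b :: a :: s) v) (hd : WordCong d)
include h hd

lemma swap_of_not_sparse_right (hSa : ¬ S a) (h2 : ¬ Sparse (fun y => y = a ∨ y = b)
    (a :: s.filter (fun y => decide (S y ∨ y = a ∨ y = b)))) :
    d (p ++ b :: a :: s) (p ++ a :: b :: s) := by
  obtain ⟨l₁, e, f, l₂, h3, he, hf⟩ := exists_of_not_sparse h2
  rw [← List.filter_cons_of_pos (by simp)] at h3
  obtain ⟨s₁, m, s₂, h4, hm⟩ := exists_of_filter_eq_append _ h3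
  have hmS : ∀ y ∈ m, ¬ S y := fun y hy hS => hm y hy (by simp [hS])
  have hef : e ≠ f := by
    rintro rfl
    rw [h4] at h
    obtain ⟨y, hy, hSy⟩ := Aligned.exists_simple (l₁ := p ++ b :: s₁) (x := e) (m := m)
      (l₂ := s₂) (by simpa using h)
    exact hmS y hy hSy
  cases s₁ with
  | nil =>
    simp only [List.nil_append, List.cons.injEq] at h4
    obtain ⟨rfl, rfl⟩ := h4
    obtain rfl : f = b := hf.resolve_left (Ne.symm hef)
    obtain ⟨y, hy, hSy⟩ := Aligned.exists_simple (l₁ := p) (x := f) (m := a :: m)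
      (l₂ := s₂) (by simpa using h)
    rcases List.mem_cons.1 hy with rfl | hy
    · exact absurd hSy hSa
    · exact absurd hSy (hmS y hy)
  | cons g s₁ =>
    simp only [List.cons_append, List.cons.injEq] at h4
    obtain ⟨rfl, rfl⟩ := h4
    obtain ⟨hnd, hmem⟩ := Aligned.nodup_of_not_simple (l₁ := p ++ b :: a :: (s₁ ++ [e]))
      (m := m) (l₂ := f :: s₂) (by simpa using h) hmS
    have hmem' : ∀ z ∈ m, z ∈ p ∨ z ∈ s₁ ∨ z ∈ s₂ := by
      intro z hz
      have hzK : ¬ (S z ∨ z = a ∨ z = b) := by simpa using hm z hz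
      have hze : z ≠ e := fun e' => hzK (Or.inr (e' ▸ he))
      have hzf : z ≠ f := fun e' => hzK (Or.inr (e' ▸ hf))
      have hza : z ≠ a := fun e' => hzK (Or.inr (Or.inl e'))
      have hzb : z ≠ b := fun e' => hzK (Or.inr (Or.inr e'))
      simpa [hze, hzf, hza, hzb, or_assoc, or_comm, or_left_comm] using hmem z hz
    rcases he with rfl | rfl <;> rcases hf with rfl | rfl
    · exact absurd rfl hef
    · exact hd.symm (hd.swap p e f s₁ m s₂ hnd hmem')
    · exact hd.swap p e f s₁ m s₂ hnd hmem'
    · exact absurd rfl hef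

lemma swap_of_not_sparse_left (hSb : ¬ S b) (h1 : ¬ Sparse (fun y => y = a ∨ y = b)
    (p.filter (fun y => decide (S y ∨ y = a ∨ y = b)) ++ [b])) :
    d (p ++ b :: a :: s) (p ++ a :: b :: s) := by
  obtain ⟨l₁, e, f, l₂, h3, he, hf⟩ := exists_of_not_sparse h1
  have h3' : (p ++ [b]).filter (fun y => decide (S y ∨ y = a ∨ y = b)) = l₁ ++ e :: f :: l₂ := by
    rw [← h3]; simp
  obtain ⟨s₁, m, s₂, h4, hm⟩ := exists_of_filter_eq_append _ h3'
  have hmS : ∀ y ∈ m, ¬ S y := fun y hy hS => hm y hy (by simp [hS])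
  have hw : p ++ b :: a :: s = s₁ ++ e :: (m ++ f :: (s₂ ++ a :: s)) := by
    have := congrArg (· ++ a :: s) h4
    simpa using this
  have hef : e ≠ f := by
    rintro rfl
    rw [hw] at h
    obtain ⟨y, hy, hSy⟩ := Aligned.exists_simple h
    exact hmS y hy hSy
  rcases List.eq_nil_or_concat' s₂ with rfl | ⟨s₂, g, rfl⟩
  · obtain ⟨h5, h6⟩ := List.append_inj' (t₁ := [b]) (t₂ := [f])
      (s₂ := s₁ ++ e :: m) (by simpa using h4) rfl
    obtain rfl : b = f := by simpa using h6
    obtain rfl : e = a := he.resolve_right hef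
    obtain ⟨y, hy, hSy⟩ := Aligned.exists_simple (l₁ := s₁) (x := e) (m := m ++ [b])
      (l₂ := s) (by rw [hw] at h; simpa using h)
    rcases List.mem_append.1 hy with hy | hy
    · exact absurd hSy (hmS y hy)
    · rw [List.mem_singleton.1 hy] at hSy
      exact absurd hSy hSb
  · obtain ⟨h5, h6⟩ := List.append_inj' (t₁ := [b]) (t₂ := [g])
      (s₂ := s₁ ++ e :: (m ++ f :: s₂)) (by simpa using h4) rfl
    obtain rfl : b = g := by simpa using h6
    subst h5
    obtain ⟨hnd, hmem⟩ := Aligned.nodup_of_not_simple (l₁ := s₁ ++ [e])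
        (m := m) (l₂ := f :: (s₂ ++ b :: a :: s)) (by simpa using h) hmS
    have hmem' : ∀ z ∈ m, z ∈ s ∨ z ∈ s₂ ∨ z ∈ s₁ := by
      intro z hz
      have hzK : ¬ (S z ∨ z = a ∨ z = b) := by simpa using hm z hz
      have hze : z ≠ e := fun e' => hzK (Or.inr (e' ▸ he))
      have hzf : z ≠ f := fun e' => hzK (Or.inr (e' ▸ hf))
      have hza : z ≠ a := fun e' => hzK (Or.inr (Or.inl e'))
      have hzb : z ≠ b := fun e' => hzK (Or.inr (Or.inr e'))
      simpa [hze, hzf, hza, hzb, or_assoc, or_comm, or_left_comm] using hmem z hz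
    rcases he with rfl | rfl <;> rcases hf with rfl | rfl
    · exact absurd rfl hef
    · simpa using hd.symm (hd.swap_rev s₁ e m f s₂ s hnd hmem')
    · simpa using hd.swap_rev s₁ e m f s₂ s hnd hmem'
    · exact absurd rfl hef


end Blocks

section Inversion

variable (h : Aligned r S (c ++ t ++ b :: a :: s) (c ++ a :: v)) (hat : a ∉ t) (hab : a ≠ b)
include h hat hab

omit h in
lemma filter_ne (Q : ℕ → Bool) (ha : Q a) (hb : Q b) :
    (c ++ t ++ b :: a :: s).filter Q ≠ (c ++ a :: v).filter Q := by
  intro e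
  simp only [List.append_assoc, List.filter_append, List.filter_cons_of_pos ha,
    List.filter_cons_of_pos hb] at e
  have e := List.append_cancel_left e
  cases hf : t.filter Q with
  | nil => rw [hf] at e; exact hab (List.cons.inj e).1.symm
  | cons g l =>
    have hg : g ∈ t.filter Q := by rw [hf]; simp
    rw [hf] at e
    exact hat ((List.cons.inj e).1 ▸ (List.mem_filter.1 hg).1)

lemma not_simple : ¬ S a ∧ ¬ S b := by
  have key : ∀ x, x = a ∨ x = b → ¬ S x → S a = false ∧ S b = false := by
    intro x hx hSx
    have h2 := h.two_le (x := x) (by rcases hx with rfl | rfl <;> simp) hSx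
    by_contra hn
    refine filter_ne (c := c) (s := s) (v := v) hat hab (fun y => decide (S y ∨ y = x)) ?_ ?_
      (h.filter_eq x h2)
    · rcases hx with rfl | rfl <;> simp_all
    · rcases hx with rfl | rfl <;> simp_all
  by_cases ha : S a
  · by_cases hb : S b
    · exact absurd h.filter_simple (filter_ne hat hab S ha hb)
    · simpa using key b (Or.inr rfl) hb
  · simpa using key a (Or.inl rfl) ha

lemma swap (hr : WordCong r) (hd : WordCong d) (hcrit : ∀ p q, Crit p q → r p q → d p q) :
    d (c ++ t ++ b :: a :: s) (c ++ t ++ a :: b :: s) := by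
  obtain ⟨hSa, hSb⟩ := h.not_simple hat hab
  let K : ℕ → Bool := fun y => decide (S y ∨ y = a ∨ y = b)
  have hKa : K a := by simp [K]
  have hKb : K b := by simp [K]
  have hne := filter_ne (c := c) (s := s) (v := v) hat hab K hKa hKb
  have ha2 := h.two_le (x := a) (by simp) hSa
  have hb2 := h.two_le (x := b) (by simp) hSb
  have hrel := h.rel
  have hsimple := h.simple
  generalize c ++ t = p at *
  have hK : (p ++ b :: a :: s).filter K = p.filter K ++ b :: a :: s.filter K := by
    simp [hKa, hKb]
  by_cases h1 : Sparse (fun y => y = a ∨ y = b) (p.filter K ++ [b])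
  · by_cases h2 : Sparse (fun y => y = a ∨ y = b) (a :: s.filter K)
    · have hc : ∀ y, y ≠ a → y ≠ b → (p.filter K ++ s.filter K).count y ≤ 1 := by
        intro y hya hyb
        by_cases hy : S y
        · have h3 := (hsimple y).1 hy
          rw [← List.filter_append]
          refine (List.filter_sublist.count_le y).trans ?_
          simp only [List.count_append, List.count_cons_of_ne (Ne.symm hya),
            List.count_cons_of_ne (Ne.symm hyb)] at h3 ⊢
          omega
        · rw [List.count_eq_zero.2]
          · omega
          · simp [K, hy, hya, hyb]
      have hcr := crit_swap hab h1 h2 hc (by rw [← hK, List.count_filter hKa]; exact ha2)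
        (by rw [← hK, List.count_filter hKb]; exact hb2)
      refine hd.swap_of_filter h1 h2 hc (hcrit _ _ hcr
        ((hcr r hr ((c ++ a :: v).filter K) ?_).resolve_left ?_))
      · rw [← hK]; exact hr.restrict K hrel
      · rw [← hK]; exact Ne.symm hne
    · exact h.swap_of_not_sparse_right hd hSa h2
  · exact h.swap_of_not_sparse_left hd hSb h1

end Inversion

end Aligned

namespace Aligned

variable {r d : List ℕ → List ℕ → Prop} {S : ℕ → Bool} {a b : ℕ} {w v : List ℕ}

lemma filter_swap {p s : List ℕ} {Q : ℕ → Bool} (hQ : ¬ (Q a ∧ Q b)) :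
    (p ++ a :: b :: s).filter Q = (p ++ b :: a :: s).filter Q := by
  by_cases ha : Q a
  · have hb : ¬ Q b := fun hb => hQ ⟨ha, hb⟩
    simp [ha, hb]
  · by_cases hb : Q b <;> simp [ha, hb]

lemma of_swap (hr : WordCong r) {p s : List ℕ} (h : Aligned r S (p ++ b :: a :: s) v)
    (hab : a ≠ b) (hS : ¬ S a ∧ ¬ S b) (hrel : r (p ++ b :: a :: s) (p ++ a :: b :: s)) :
    Aligned r S (p ++ a :: b :: s) v := by
  have hperm : (p ++ a :: b :: s).Perm (p ++ b :: a :: s) := (List.Perm.swap _ _ _).append_left p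
  have hf : ∀ x, (p ++ a :: b :: s).filter (fun y => decide (S y ∨ y = x)) =
      (p ++ b :: a :: s).filter (fun y => decide (S y ∨ y = x)) := fun x =>
    filter_swap fun h' => by
      simp only [decide_eq_true_eq] at h'
      exact hab ((h'.1.resolve_left hS.1).trans (h'.2.resolve_left hS.2).symm)
  refine ⟨hr.trans (hr.symm hrel) h.rel, hperm.trans h.perm, fun y => ?_, ?_, fun x hx => ?_,
    fun x hx => ?_⟩
  · rw [hperm.count_eq]; exact h.simple y
  · rw [filter_swap fun h' => hS.1 h'.1]; exact h.filter_simple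
  · rw [hperm.count_eq] at hx
    rw [hf]; exact h.filter_eq x hx
  · rw [hperm.count_eq] at hx
    rw [hf]; exact h.sparse x hx

lemma transfer (hr : WordCong r) (hd : WordCong d) (hdr : ∀ u v, d u v → r u v)
    (hcrit : ∀ p q, Crit p q → r p q → d p q) (h : Aligned r S w v) : d w v := by
  have key : ∀ (v c w : List ℕ), Aligned r S (c ++ w) (c ++ v) → d (c ++ w) (c ++ v) := by
    intro v
    induction v with
    | nil =>
      intro c w h
      obtain rfl : w = [] := List.perm_nil.1 ((List.perm_append_left_iff c).1 h.perm)
      exact hd.refl _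
    | cons a v ih =>
      intro c w h
      have haw : a ∈ w := ((List.perm_append_left_iff c).1 h.perm).mem_iff.2 (by simp)
      obtain ⟨t, s, rfl, hat⟩ := List.eq_append_cons_of_mem haw
      clear haw
      induction t using List.reverseRecOn generalizing s with
      | nil =>
        have := ih (c ++ [a]) s (by simpa using h)
        simpa using this
      | append_singleton t b iht =>
        simp only [List.mem_append, List.mem_singleton, not_or] at hat
        obtain ⟨hat, hab⟩ := hat
        have h' : Aligned r S (c ++ t ++ b :: a :: s) (c ++ a :: v) := by simpa using h
        have hsw := h'.swap hat hab hr hd hcrit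
        have h2 := h'.of_swap hr hab (h'.not_simple hat hab) (hdr _ _ hsw)
        have := iht (b :: s) hat (by simpa using h2)
        exact hd.trans (by simpa using hsw) (by simpa using this)
  exact key v [] w h

end Aligned

namespace WordCong

variable {r d : List ℕ → List ℕ → Prop} {u v : List ℕ}

lemma le_of_crit (hr : WordCong r) (hd : WordCong d) (hdr : ∀ u v, d u v → r u v)
    (hcrit : ∀ p q, Crit p q → r p q → d p q) (h : r u v) : d u v := by
  by_cases hc : Commutes r
  · exact hr.le_of_crit_of_commutes hd hcrit hc h
  induction hn : u.length + v.length using Nat.strong_induction_on generalizing u v with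
  | _ n ih =>
    have hcount : ∀ y, u.count y = 1 ↔ v.count y = 1 := fun y =>
      ⟨fun hy => (hr.count_eq hc h hy.le).trans hy,
        fun hy => (hr.count_eq hc (hr.symm h) hy.le).trans hy⟩
    by_cases hx : ∃ x, 2 ≤ u.count x ∧ d u (x :: x :: del x u) ∧ d v (x :: x :: del x v)
    · obtain ⟨x, hx, h1, h2⟩ := hx
      have hlt : (del x u).length < u.length :=
        List.length_filter_lt_length_iff_exists.2
          ⟨x, List.count_pos_iff.1 (by omega), by simp⟩
      have hle : (del x v).length ≤ v.length := List.length_filter_le _ _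
      have h3 := ih ((del x u).length + (del x v).length) (by omega) (hr.erase h) rfl
      exact hd.trans h1 (hd.trans (hd.appL (l := [x, x]) h3) (hd.symm h2))
    · push Not at hx
      let S : ℕ → Bool := fun y => decide (u.count y = 1)
      have hmain : ∀ x, 2 ≤ u.count x → u.filter (fun y => decide (u.count y = 1 ∨ y = x)) =
          v.filter (fun y => decide (u.count y = 1 ∨ y = x)) ∧
          Sparse (· = x) (u.filter fun y => decide (u.count y = 1 ∨ y = x)) := by
        intro x hxu
        by_contra hne
        refine hx x hxu (hr.square_of_filter_ne hd hcrit h hxu hne)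
          (hr.square_of_filter_ne hd hcrit (hr.symm h) (hr.two_le_count hc h hxu) fun h' => hne ?_)
        simp only [← hcount] at h'
        exact ⟨h'.1.symm, h'.1 ▸ h'.2⟩
      have hS : u.filter S = v.filter S := by
        refine hr.eq_of_nodup hc (hr.restrict S h) (List.nodup_iff_count_le_one.2 fun y => ?_)
        by_cases hy : S y
        · rw [List.count_filter hy]
          simp only [S, decide_eq_true_eq] at hy
          exact hy.le
        · rw [List.count_eq_zero.2 (by simp [hy])]; omega
      have hperm : u.Perm v := by
        rw [List.perm_iff_count]
        intro y
        rcases Nat.lt_or_ge (u.count y) 2 with hy | hy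
        · exact (hr.count_eq hc h (Nat.le_of_lt_succ hy)).symm
        · have := congrArg (List.count y) (hmain y hy).1
          rwa [List.count_filter (by simp), List.count_filter (by simp)] at this
      refine Aligned.transfer (S := S) hr hd hdr hcrit
        ⟨h, hperm, fun y => by simp [S], hS, fun x hx => ?_, fun x hx => ?_⟩
      · simpa [S] using (hmain x hx).1
      · simpa [S] using (hmain x hx).2

end WordCong

section Arrangement

lemma exists_perm_of_perm {α : Type*} {n : ℕ} {f g : Fin n → α}
    (h : (List.ofFn f).Perm (List.ofFn g)) : ∃ e : Equiv.Perm (Fin n), ∀ i, g (e i) = f i := by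
  classical
  have hcard : ∀ c, Fintype.card {i // f i = c} = Fintype.card {i // g i = c} := by
    intro c
    have h1 : ∀ f : Fin n → α, Fintype.card {i // f i = c} = (List.ofFn f).count c := by
      intro f
      rw [Fintype.card_subtype, ← Multiset.coe_count, ← Fin.univ_val_map, Multiset.count_map]
      simp only [eq_comm]
      rfl
    rw [h1, h1, h.count_eq]
  exact ⟨Equiv.ofFiberEquiv fun c => Fintype.equivOfCardEq (hcard c),
    fun i => Equiv.ofFiberEquiv_map _ i⟩

lemma range_succ_flatMap {α : Type*} (n : ℕ) (f : ℕ → List α) :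
    (List.range (n + 1)).flatMap f = f 0 ++ (List.range n).flatMap fun i => f (i + 1) := by
  rw [List.range_succ_eq_map, List.flatMap_cons, List.flatMap_map]

/-- A word containing given letters as a subword, decomposed around these letters. -/
lemma exists_prefix_decomposition (n : ℕ) (Z : ℕ → List ℕ) (p : List ℕ)
    (hZ : ∀ i, Z i = [] ∨ ∃ c, Z i = [c]) (h : ((List.range n).flatMap Z).Sublist p) :
    ∃ (A : List ℕ) (T : ℕ → List ℕ), p = A ++ (List.range n).flatMap fun i => Z i ++ T i := by
  induction n generalizing Z p with
  | zero => exact ⟨p, fun _ => [], by simp⟩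
  | succ n ih =>
    simp only [range_succ_flatMap] at h ⊢
    rcases hZ 0 with h0 | ⟨c, h0⟩
    · rw [h0] at h ⊢
      obtain ⟨A, T, hT⟩ := ih (fun i => Z (i + 1)) p (fun i => hZ _) h
      exact ⟨[], fun i => Nat.casesOn i A T, by simpa using hT⟩
    · rw [h0, List.singleton_append, List.cons_sublist_iff] at h
      obtain ⟨p₁, p₂, rfl, hc, h2⟩ := h
      obtain ⟨u, v, rfl⟩ := List.append_of_mem hc
      obtain ⟨A, T, hT⟩ := ih (fun i => Z (i + 1)) p₂ (fun i => hZ _) h2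
      refine ⟨u, fun i => Nat.casesOn i (v ++ A) T, ?_⟩
      conv_lhs => rw [hT]
      simp [h0]

lemma exists_suffix_decomposition (n : ℕ) (Z : ℕ → List ℕ) (p : List ℕ)
    (hZ : ∀ i, Z i = [] ∨ ∃ c, Z i = [c]) (h : ((List.range n).flatMap Z).Sublist p) :
    ∃ (B : List ℕ) (T : ℕ → List ℕ), p = ((List.range n).flatMap fun i => T i ++ Z i) ++ B := by
  induction n generalizing Z p with
  | zero => exact ⟨p, fun _ => [], by simp⟩
  | succ n ih =>
    simp only [range_succ_flatMap] at h ⊢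
    rcases hZ 0 with h0 | ⟨c, h0⟩
    · rw [h0] at h ⊢
      obtain ⟨B, T, hT⟩ := ih (fun i => Z (i + 1)) p (fun i => hZ _) h
      exact ⟨B, fun i => Nat.casesOn i [] T, by simpa using hT⟩
    · rw [h0, List.singleton_append, List.cons_sublist_iff] at h
      obtain ⟨p₁, p₂, rfl, hc, h2⟩ := h
      obtain ⟨u, v, rfl⟩ := List.append_of_mem hc
      obtain ⟨B, T, hT⟩ := ih (fun i => Z (i + 1)) (v ++ p₂) (fun i => hZ _)
        (h2.trans (List.sublist_append_right _ _))
      refine ⟨B, fun i => Nat.casesOn i u T, ?_⟩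
      simp only [List.append_assoc, List.cons_append]
      rw [hT]
      simp [h0]

lemma ofFn_getD {α : Type*} {n : ℕ} (l : List α) (x : α) (h : l.length = n) :
    List.ofFn (fun i : Fin n => l.getD i x) = l := by
  subst h
  apply List.ext_getElem <;> simp

lemma range_flatMap_getD {α : Type*} (l : List (List α)) :
    (List.range l.length).flatMap (fun i => l.getD i []) = l.flatten := by
  induction l with
  | nil => rfl
  | cons a l ih => rw [List.length_cons, range_succ_flatMap]; simpa using ih

/-- Some letters of `a` that occur in `p` are listed in an order in which they occur in `p`. -/
lemma exists_arrangement {a p : List ℕ} (ha : a.Nodup) (M : ℕ → Bool)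
    (hM : ∀ c ∈ a, M c → c ∈ p) :
    ∃ (π : Equiv.Perm (Fin a.length)) (Z : ℕ → List ℕ), (∀ i, Z i = [] ∨ ∃ c, Z i = [c]) ∧
      ((List.range a.length).flatMap Z).Sublist p ∧
      ∀ i : Fin a.length, Z (π i) = if M a[i] then [a[i]] else [] := by
  let L := p.dedup.filter fun c => decide (c ∈ a ∧ M c)
  let Y : List (List ℕ) := L.map (fun c => [c]) ++ (a.filter fun c => !M c).map fun _ => []
  let X : List (List ℕ) := a.map fun c => if M c then [c] else []
  have hL : (a.filter fun c => M c).Perm L := by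
    rw [List.perm_ext_iff_of_nodup (ha.filter _) (p.nodup_dedup.filter _)]
    intro c
    simp only [List.mem_filter, List.mem_dedup, decide_eq_true_eq]
    exact ⟨fun h => ⟨hM c h.1 h.2, h⟩, fun h => h.2⟩
  have hXY : X.Perm Y := by
    have h1 := ((List.filter_append_perm (fun c => M c) a).symm.map
      fun c => if M c then [c] else [])
    refine h1.trans ?_
    rw [List.map_append]
    refine List.Perm.append ?_ ?_
    · rw [List.map_congr_left (g := fun c => [c]) fun c hc => by
        simp [(List.mem_filter.1 hc).2]]
      exact hL.map _
    · rw [List.map_congr_left (g := fun _ => []) fun c hc => by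
        have := (List.mem_filter.1 hc).2
        simp_all]
  have hXl : X.length = a.length := by simp [X]
  have hYl : Y.length = a.length := hXY.length_eq.symm.trans hXl
  obtain ⟨π, hπ⟩ := exists_perm_of_perm
    (f := fun i : Fin a.length => X.getD i []) (g := fun i : Fin a.length => Y.getD i [])
    (by rwa [ofFn_getD X [] hXl, ofFn_getD Y [] hYl])
  refine ⟨π, fun i => Y.getD i [], fun i => ?_, ?_, fun i => ?_⟩
  · beta_reduce
    rcases Nat.lt_or_ge i Y.length with hi | hi
    · rw [List.getD_eq_getElem _ _ hi]
      have := List.getElem_mem hi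
      simp only [Y, List.mem_append, List.mem_map] at this
      rcases this with ⟨c, -, h⟩ | ⟨c, -, h⟩
      · exact Or.inr ⟨c, h.symm⟩
      · exact Or.inl h.symm
    · exact Or.inl (List.getD_eq_default _ _ hi)
  · rw [← hYl, range_flatMap_getD]
    have : Y.flatten = L := by
      simp only [Y, List.flatten_append, ← List.flatMap_def]
      simp
    rw [this]
    exact List.filter_sublist.trans p.dedup_sublist
  · beta_reduce
    rw [hπ i]
    simp [X]

end Arrangement

section Substitution

/-- The substitution with the given values on the letters of the identities defining `A'`. -/
def letterSub (X Y T₀ : List ℕ) (Z T : ℕ → List ℕ) (k : ℕ) : List ℕ :=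
  if k = 0 then X else if k = 1 then Y else if k < 10 then T₀
  else if k % 2 = 0 then Z ((k - 10) / 2) else T ((k - 11) / 2)

variable (X Y T₀ : List ℕ) (Z T : ℕ → List ℕ)

@[simp] lemma letterSub_zero : letterSub X Y T₀ Z T 0 = X := rfl

@[simp] lemma letterSub_one : letterSub X Y T₀ Z T 1 = Y := rfl

@[simp] lemma letterSub_four : letterSub X Y T₀ Z T 4 = T₀ := rfl

@[simp] lemma letterSub_even (i : ℕ) : letterSub X Y T₀ Z T (10 + 2 * i) = Z i := by
  have h1 : (10 + 2 * i) % 2 = 0 := by omega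
  have h2 : (10 + 2 * i - 10) / 2 = i := by omega
  have h3 : ¬ 10 + 2 * i = 0 := by omega
  have h4 : ¬ 10 + 2 * i = 1 := by omega
  have h5 : ¬ 10 + 2 * i < 10 := by omega
  rw [letterSub, if_neg h3, if_neg h4, if_neg h5, if_pos h1, h2]

@[simp] lemma letterSub_odd (i : ℕ) : letterSub X Y T₀ Z T (11 + 2 * i) = T i := by
  have h1 : ¬ (11 + 2 * i) % 2 = 0 := by omega
  have h2 : (11 + 2 * i - 11) / 2 = i := by omega
  have h3 : ¬ 11 + 2 * i = 0 := by omega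
  have h4 : ¬ 11 + 2 * i = 1 := by omega
  have h5 : ¬ 11 + 2 * i < 10 := by omega
  rw [letterSub, if_neg h3, if_neg h4, if_neg h5, if_neg h1, h2]

lemma flatMap_toList_prod {ι : Type*} (l : List ι) (f : ι → FM) (φ : ℕ → List ℕ) :
    (FreeMonoid.toList (l.map f).prod).flatMap φ =
      l.flatMap fun i => (FreeMonoid.toList (f i)).flatMap φ := by
  induction l with
  | nil => rfl
  | cons a l ih =>
    rw [List.map_cons, List.prod_cons, FreeMonoid.toList_mul, List.flatMap_append, ih,
      List.flatMap_cons]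

@[simp] lemma flatMap_toList_prodRange (n : ℕ) (f : ℕ → FM) (φ : ℕ → List ℕ) :
    (FreeMonoid.toList (prodRange n f)).flatMap φ =
      (List.range n).flatMap fun i => (FreeMonoid.toList (f i)).flatMap φ :=
  flatMap_toList_prod _ _ _

@[simp] lemma flatMap_toList_prodFin (n : ℕ) (f : Fin n → FM) (φ : ℕ → List ℕ) :
    (FreeMonoid.toList (prodFin n f)).flatMap φ =
      (List.finRange n).flatMap fun i => (FreeMonoid.toList (f i)).flatMap φ :=
  flatMap_toList_prod _ _ _

lemma flatMap_wWord (n : ℕ) (π τ : Equiv.Perm (Fin n)) :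
    (FreeMonoid.toList (wWord n π τ)).flatMap (letterSub X Y T₀ Z T) =
      ((List.range n).flatMap fun i => Z i ++ T i) ++ X ++
      ((List.finRange n).flatMap fun i => Z (π i) ++ Z (n + τ i)) ++ X ++
      (List.range n).flatMap fun i => T (n + i) ++ Z (n + i) := by
  simp [wWord, zV, tV, xL, FreeMonoid.toList_mul]

lemma flatMap_wWord' (n : ℕ) (π τ : Equiv.Perm (Fin n)) :
    (FreeMonoid.toList (wWord' n π τ)).flatMap (letterSub X Y T₀ Z T) =
      ((List.range n).flatMap fun i => Z i ++ T i) ++ X ++ X ++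
      ((List.finRange n).flatMap fun i => Z (π i) ++ Z (n + τ i)) ++
      (List.range n).flatMap fun i => T (n + i) ++ Z (n + i) := by
  simp [wWord', zV, tV, xL, FreeMonoid.toList_mul]

lemma flatMap_cWord3 (n m k : ℕ) (ρ : Equiv.Perm (Fin (n + m + k))) :
    (FreeMonoid.toList (cWord3 n m k ρ)).flatMap (letterSub X Y T₀ Z T) =
      ((List.range n).flatMap fun i => Z i ++ T i) ++ X ++ Y ++ T₀ ++
      ((List.range m).flatMap fun i => Z (n + i) ++ T (n + i)) ++ X ++
      ((List.finRange (n + m + k)).flatMap fun i => Z (ρ i)) ++ Y ++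
      (List.range k).flatMap fun i => T (n + m + i) ++ Z (n + m + i) := by
  simp [cWord3, zV, tV, xL, yL, tL, FreeMonoid.toList_mul]

lemma flatMap_cWord3' (n m k : ℕ) (ρ : Equiv.Perm (Fin (n + m + k))) :
    (FreeMonoid.toList (cWord3' n m k ρ)).flatMap (letterSub X Y T₀ Z T) =
      ((List.range n).flatMap fun i => Z i ++ T i) ++ Y ++ X ++ T₀ ++
      ((List.range m).flatMap fun i => Z (n + i) ++ T (n + i)) ++ X ++
      ((List.finRange (n + m + k)).flatMap fun i => Z (ρ i)) ++ Y ++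
      (List.range k).flatMap fun i => T (n + m + i) ++ Z (n + m + i) := by
  simp [cWord3', zV, tV, xL, yL, tL, FreeMonoid.toList_mul]

end Substitution

section Instances

lemma range_flatMap_congr {n : ℕ} {f g : ℕ → List ℕ} (h : ∀ i < n, f i = g i) :
    (List.range n).flatMap f = (List.range n).flatMap g :=
  flatMap_congr_mem fun i hi => h i (List.mem_range.1 hi)

lemma range_flatMap_getD_middle (l₁ l₂ l₃ : List ℕ) :
    ((List.range l₂.length).flatMap fun i => [(l₁ ++ l₂ ++ l₃).getD (l₁.length + i) 0]) = l₂ := by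
  rw [← List.map_eq_flatMap]
  refine List.ext_getElem (by simp) fun i h1 h2 => ?_
  simp [List.getElem?_append, h2]

lemma exists_square_instance (p : List ℕ) (x : ℕ) (a q : List ℕ) (ha : a.Nodup)
    (h : ∀ y ∈ a, y ∈ p ∨ y ∈ q) :
    ∃ (π τ : Equiv.Perm (Fin a.length)) (φ : ℕ → List ℕ) (A B : List ℕ),
      p ++ x :: (a ++ x :: q) =
        A ++ (FreeMonoid.toList (wWord a.length π τ)).flatMap φ ++ B ∧
      p ++ x :: x :: (a ++ q) =
        A ++ (FreeMonoid.toList (wWord' a.length π τ)).flatMap φ ++ B := by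
  obtain ⟨π, Z₁, hZ₁, hp, hπ⟩ := exists_arrangement (p := p) ha (fun c => decide (c ∈ p))
    fun c _ hc => of_decide_eq_true hc
  obtain ⟨τ, Z₂, hZ₂, hq, hτ⟩ := exists_arrangement (p := q) ha (fun c => !decide (c ∈ p))
    fun c hc hcp => (h c hc).resolve_left (by simpa using hcp)
  obtain ⟨A, T₁, hA⟩ := exists_prefix_decomposition _ Z₁ p hZ₁ hp
  obtain ⟨B, T₂, hB⟩ := exists_suffix_decomposition _ Z₂ q hZ₂ hq
  let Z : ℕ → List ℕ := fun i => if i < a.length then Z₁ i else Z₂ (i - a.length)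
  let T : ℕ → List ℕ := fun i => if i < a.length then T₁ i else T₂ (i - a.length)
  have h1 : ((List.range a.length).flatMap fun i => Z i ++ T i) =
      (List.range a.length).flatMap fun i => Z₁ i ++ T₁ i :=
    range_flatMap_congr fun i hi => by simp [Z, T, hi]
  have h2 : ((List.range a.length).flatMap fun i => T (a.length + i) ++ Z (a.length + i)) =
      (List.range a.length).flatMap fun i => T₂ i ++ Z₂ i :=
    range_flatMap_congr fun i hi => by simp [Z, T]
  have h3 : ((List.finRange a.length).flatMap fun i => Z (π i) ++ Z (a.length + τ i)) = a := by
    have : (fun i : Fin a.length => Z (π i) ++ Z (a.length + τ i)) = fun i => [a[i]] := by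
      funext i
      have e1 : Z (π i) = Z₁ (π i) := by simp [Z]
      have e2 : Z (a.length + τ i) = Z₂ (τ i) := by simp [Z]
      rw [e1, e2, hπ, hτ]
      by_cases hc : a[(i : ℕ)] ∈ p <;> simp [hc]
    rw [this, ← List.map_eq_flatMap]
    refine List.ext_getElem (by simp) fun i _ _ => by simp
  refine ⟨π, τ, letterSub [x] [] [] Z T, A, B, ?_, ?_⟩
  · rw [flatMap_wWord, h1, h2, h3]
    conv_lhs => rw [hA, hB]
    simp
  · rw [flatMap_wWord', h1, h2, h3]
    conv_lhs => rw [hA, hB]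
    simp

lemma exists_swap_instance (p : List ℕ) (x y : ℕ) (q a s : List ℕ) (ha : a.Nodup)
    (h : ∀ z ∈ a, z ∈ p ∨ z ∈ q ∨ z ∈ s) :
    ∃ (n m k : ℕ) (ρ : Equiv.Perm (Fin (n + m + k))) (φ : ℕ → List ℕ) (A B : List ℕ),
      p ++ x :: y :: (q ++ x :: (a ++ y :: s)) =
        A ++ (FreeMonoid.toList (cWord3 n m k ρ)).flatMap φ ++ B ∧
      p ++ y :: x :: (q ++ x :: (a ++ y :: s)) =
        A ++ (FreeMonoid.toList (cWord3' n m k ρ)).flatMap φ ++ B := by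
  set L₁ := p.dedup.filter fun c => decide (c ∈ a) with hL₁
  set L₂ := q.dedup.filter fun c => decide (c ∈ a ∧ c ∉ p) with hL₂
  set L₃ := s.dedup.filter fun c => decide (c ∈ a ∧ c ∉ p ∧ c ∉ q) with hL₃
  have hperm : a.Perm (L₁ ++ L₂ ++ L₃) := by
    rw [List.perm_ext_iff_of_nodup ha]
    · intro c
      have := h c
      simp only [hL₁, hL₂, hL₃, List.mem_append, List.mem_filter, List.mem_dedup,
        decide_eq_true_eq]
      tauto
    · rw [List.nodup_append', List.nodup_append']
      refine ⟨⟨p.nodup_dedup.filter _, q.nodup_dedup.filter _, ?_⟩, s.nodup_dedup.filter _, ?_⟩ <;>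
      · intro c
        simp only [hL₁, hL₂, hL₃, List.mem_append, List.mem_filter, List.mem_dedup,
          decide_eq_true_eq]
        tauto
  have hlen : a.length = L₁.length + L₂.length + L₃.length := by
    rw [hperm.length_eq, List.length_append, List.length_append]
  let L := L₁ ++ L₂ ++ L₃
  obtain ⟨ρ, hρ⟩ := exists_perm_of_perm
    (f := fun i : Fin (L₁.length + L₂.length + L₃.length) => a.getD i 0)
    (g := fun i : Fin (L₁.length + L₂.length + L₃.length) => L.getD i 0)
    (by rwa [ofFn_getD a 0 hlen, ofFn_getD L 0 (by simp only [L, List.length_append])])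
  let Z : ℕ → List ℕ := fun i => [L.getD i 0]
  have hZ : ∀ i, Z i = [] ∨ ∃ c, Z i = [c] := fun i => Or.inr ⟨_, rfl⟩
  have hZ₁ : (List.range L₁.length).flatMap Z = L₁ := by
    simpa [Z, L] using range_flatMap_getD_middle [] L₁ (L₂ ++ L₃)
  have hZ₂ : ((List.range L₂.length).flatMap fun i => Z (L₁.length + i)) = L₂ :=
    range_flatMap_getD_middle L₁ L₂ L₃
  have hZ₃ : ((List.range L₃.length).flatMap fun i => Z (L₁.length + L₂.length + i)) = L₃ := by
    simpa [Z, L] using range_flatMap_getD_middle (L₁ ++ L₂) L₃ []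
  have sub : ∀ (l : List ℕ) (K : ℕ → Bool), (l.dedup.filter K).Sublist l :=
    fun l K => List.filter_sublist.trans l.dedup_sublist
  obtain ⟨A, T₁, hA⟩ := exists_prefix_decomposition L₁.length Z p hZ (by rw [hZ₁]; exact sub _ _)
  obtain ⟨T₀, T₂, hT₀⟩ := exists_prefix_decomposition L₂.length (fun i => Z (L₁.length + i)) q
    (fun i => hZ _) (by rw [hZ₂]; exact sub _ _)
  obtain ⟨B, T₃, hB⟩ := exists_suffix_decomposition L₃.length
    (fun i => Z (L₁.length + L₂.length + i)) s (fun i => hZ _) (by rw [hZ₃]; exact sub _ _)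
  have ha' : ((List.finRange (L₁.length + L₂.length + L₃.length)).flatMap fun i => Z (ρ i)) =
      a := by
    have : (fun i : Fin (L₁.length + L₂.length + L₃.length) => Z (ρ i)) =
        fun i : Fin _ => [a.getD i 0] := by
      funext i
      simp only [Z, hρ]
    rw [this, ← List.map_eq_flatMap, ← List.ofFn_eq_map, ofFn_getD a 0 hlen]
  generalize L₁.length = n at *
  generalize L₂.length = m at *
  generalize L₃.length = k at *
  let T : ℕ → List ℕ := fun i =>
    if i < n then T₁ i else if i < n + m then T₂ (i - n) else T₃ (i - (n + m))
  have h1 : ((List.range n).flatMap fun i => Z i ++ T i) =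
      (List.range n).flatMap fun i => Z i ++ T₁ i :=
    range_flatMap_congr fun i hi => by simp [T, hi]
  have h2 : ((List.range m).flatMap fun i => Z (n + i) ++ T (n + i)) =
      (List.range m).flatMap fun i => Z (n + i) ++ T₂ i :=
    range_flatMap_congr fun i hi => by simp [T, hi]
  have h3 : ((List.range k).flatMap fun i => T (n + m + i) ++ Z (n + m + i)) =
      (List.range k).flatMap fun i => T₃ i ++ Z (n + m + i) :=
    range_flatMap_congr fun i hi => by
      have e1 : ¬ n + m + i < n := by omega
      simp [T, e1]
  refine ⟨n, m, k, ρ, letterSub [x] [y] T₀ Z T, A, B, ?_, ?_⟩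
  · rw [flatMap_cWord3, h1, h2, h3, ha']
    conv_lhs => rw [hA, hT₀, hB]
    simp
  · rw [flatMap_cWord3', h1, h2, h3, ha']
    conv_lhs => rw [hA, hT₀, hB]
    simp

end Instances

section Congruences

/-- A congruence on the free monoid as a relation on lists. -/
def wordRel (θ : Con FM) (u v : List ℕ) : Prop := θ (FreeMonoid.ofList u) (FreeMonoid.ofList v)

variable {θ α β : Con FM}

lemma wordRel_toList {u v : FM} :
    wordRel θ (FreeMonoid.toList u) (FreeMonoid.toList v) ↔ θ u v := Iff.rfl

lemma wordRel_append {a b c d : List ℕ} (h₁ : wordRel θ a b) (h₂ : wordRel θ c d) :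
    wordRel θ (a ++ c) (b ++ d) := θ.mul h₁ h₂

lemma IsFullyInvariant.wordRel_flatMap (hθ : IsFullyInvariant θ) (s : ℕ → List ℕ) {u v : List ℕ}
    (h : wordRel θ u v) : wordRel θ (u.flatMap s) (v.flatMap s) := by
  have key : ∀ l : List ℕ,
      FreeMonoid.lift (fun a => FreeMonoid.ofList (s a)) (FreeMonoid.ofList l) =
        FreeMonoid.ofList (l.flatMap s) := by
    intro l
    induction l with
    | nil => rfl
    | cons a l ih =>
      rw [FreeMonoid.ofList_cons, map_mul, ih, FreeMonoid.lift_eval_of, List.flatMap_cons,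
        FreeMonoid.ofList_append]
  have := hθ (FreeMonoid.lift fun a => FreeMonoid.ofList (s a)) _ _ h
  rwa [key, key] at this

lemma IsFullyInvariant.wordRel_context (hθ : IsFullyInvariant θ) (s : ℕ → List ℕ) {u v : FM}
    (h : θ u v) (A B : List ℕ) :
    wordRel θ (A ++ (FreeMonoid.toList u).flatMap s ++ B)
      (A ++ (FreeMonoid.toList v).flatMap s ++ B) :=
  wordRel_append (wordRel_append (θ.refl _) (hθ.wordRel_flatMap s (wordRel_toList.2 h))) (θ.refl _)

lemma fiCon_basis {E : Set (FM × FM)} {u v : FM} (h : (u, v) ∈ E) (hθ : fiCon E ≤ θ) : θ u v := by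
  refine hθ ?_
  intro c hc
  exact hc.2 _ h

lemma reverse_flatMap_toList (w : FM) (φ : ℕ → List ℕ) :
    ((FreeMonoid.toList w).flatMap φ).reverse =
      (FreeMonoid.toList w.reverse).flatMap (List.reverse ∘ φ) :=
  List.reverse_flatMap

lemma wordCong_wordRel (hθ : IsFullyInvariant θ) (h : θA' ≤ θ) : WordCong (wordRel θ) := by
  have hcentral : ∀ x l, wordRel θ (x :: x :: l) (l ++ [x, x]) := by
    intro x l
    have h1 : θ (xL ^ 2 * yL) (yL * xL ^ 2) := by
      refine fiCon_basis ?_ h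
      simp [basisA']
    simpa [xL, yL, pow_two, FreeMonoid.toList_mul] using
      hθ.wordRel_context (fun a => if a = 0 then [x] else l) h1 [] []
  refine
    { refl := fun u => θ.refl _
      symm := fun h => θ.symm h
      trans := fun h h' => θ.trans h h'
      app := wordRel_append
      sub := fun s => hθ.wordRel_flatMap s
      cube := fun x => ?_
      central := hcentral
      square := fun p x a q ha hpq => ?_
      swap := fun p x y q a s ha hz => ?_
      swap_rev := fun s y a x q p ha hz => ?_ }
  · have h1 : θ (xL ^ 2) (xL ^ 3) := by
      refine fiCon_basis ?_ h
      simp [basisA']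
    suffices hx : wordRel θ [x, x] [x, x, x] from θ.symm hx
    simpa [xL, pow_succ, FreeMonoid.toList_mul] using
      hθ.wordRel_context (fun a => [x]) h1 [] []
  · have hmove : wordRel θ (p ++ x :: x :: (a ++ q)) (x :: x :: (p ++ a ++ q)) := by
      have h1 := wordRel_append (hcentral x p) (θ.refl (FreeMonoid.ofList (a ++ q)))
      refine θ.symm ?_
      change wordRel θ (x :: x :: (p ++ a ++ q)) (p ++ x :: x :: (a ++ q))
      rw [List.append_assoc]
      rwa [List.append_assoc] at h1
    refine θ.trans ?_ hmove
    rcases Nat.eq_zero_or_pos a.length with h0 | h0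
    · rw [List.length_eq_zero_iff] at h0
      subst h0
      exact θ.refl _
    · obtain ⟨π, τ, φ, A, B, e1, e2⟩ := exists_square_instance p x a q ha hpq
      rw [e1, e2]
      exact hθ.wordRel_context φ (fiCon_basis (Or.inl (Or.inr ⟨_, π, τ, h0, rfl⟩)) h) A B
  · obtain ⟨n, m, k, ρ, φ, A, B, e1, e2⟩ := exists_swap_instance p x y q a s ha hz
    rw [e1, e2]
    exact hθ.wordRel_context φ (fiCon_basis (Or.inr ⟨n, m, k, ρ, Or.inl rfl⟩) h) A B
  · obtain ⟨n, m, k, ρ, φ, A, B, e1, e2⟩ := exists_swap_instance p.reverse x y q.reverse a.reverse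
      s.reverse (List.nodup_reverse.2 ha) (by simpa using hz)
    have e1 := congrArg List.reverse e1
    have e2 := congrArg List.reverse e2
    simp only [List.reverse_append, List.reverse_cons, List.reverse_reverse, List.append_assoc,
      List.cons_append, List.nil_append, reverse_flatMap_toList] at e1 e2
    rw [e1, e2, ← List.append_assoc, ← List.append_assoc]
    exact hθ.wordRel_context _ (fiCon_basis (Or.inr ⟨n, m, k, ρ, Or.inr rfl⟩) h) _ _

lemma IsFullyInvariant.sup (hα : IsFullyInvariant α) (hβ : IsFullyInvariant β) :
    IsFullyInvariant (α ⊔ β) := by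
  intro σ u v h
  have hle : α ⊔ β ≤ Con.comap σ (map_mul σ) (α ⊔ β) :=
    sup_le (fun {x y} hxy => (le_sup_left : α ≤ α ⊔ β) (hα σ x y hxy))
      fun {x y} hxy => (le_sup_right : β ≤ α ⊔ β) (hβ σ x y hxy)
  exact hle h

lemma IsFullyInvariant.inf (hα : IsFullyInvariant α) (hβ : IsFullyInvariant β) :
    IsFullyInvariant (α ⊓ β) := by
  intro σ u v h
  rw [Con.inf_iff_and] at h ⊢
  exact ⟨hα σ u v h.1, hβ σ u v h.2⟩

/-- A word that is isolated for two congruences is isolated for their join. -/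
lemma Con.eq_of_sup {M : Type*} [Mul M] {α β : Con M} {p q : M} (hα : ∀ v, α p v → v = p)
    (hβ : ∀ v, β p v → v = p) (h : (α ⊔ β) p q) : q = p := by
  let R : M → M → Prop := fun u v => α u v ∨ β u v
  have hl : ∀ a {b c}, Relation.EqvGen R b c → Relation.EqvGen R (a * b) (a * c) := by
    intro a b c hbc
    induction hbc with
    | rel b c h => exact .rel _ _ (h.imp (α.mul (α.refl a)) (β.mul (β.refl a)))
    | refl b => exact .refl _
    | symm b c _ ih => exact .symm _ _ ih
    | trans b c d _ _ ih₁ ih₂ => exact .trans _ _ _ ih₁ ih₂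
  have hr : ∀ a {b c}, Relation.EqvGen R b c → Relation.EqvGen R (b * a) (c * a) := by
    intro a b c hbc
    induction hbc with
    | rel b c h => exact .rel _ _ (h.imp (α.mul · (α.refl a)) (β.mul · (β.refl a)))
    | refl b => exact .refl _
    | symm b c _ ih => exact .symm _ _ ih
    | trans b c d _ _ ih₁ ih₂ => exact .trans _ _ _ ih₁ ih₂
  let c : Con M :=
    { r := Relation.EqvGen R
      iseqv := Relation.EqvGen.is_equivalence R
      mul' := fun h₁ h₂ => .trans _ _ _ (hr _ h₁) (hl _ h₂) }
  have hle : α ⊔ β ≤ c :=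
    sup_le (fun {x y} hxy => Relation.EqvGen.rel x y (Or.inl hxy))
      fun {x y} hxy => Relation.EqvGen.rel x y (Or.inr hxy)
  have key : ∀ {u v}, Relation.EqvGen R u v → (u = p ↔ v = p) := by
    intro u v huv
    induction huv with
    | rel u v hr =>
      constructor
      · rintro rfl
        exact hr.elim (hα v) (hβ v)
      · rintro rfl
        exact hr.elim (fun h => hα u (α.symm h)) fun h => hβ u (β.symm h)
    | refl u => rfl
    | symm u v _ ih => exact ih.symm
    | trans u v w _ _ ih₁ ih₂ => exact ih₁.trans ih₂
  exact (key (hle h)).1 rfl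

lemma Crit.of_sup {p q : List ℕ} (hpq : Crit p q) (hα : WordCong (wordRel α))
    (hβ : WordCong (wordRel β)) (h : wordRel (α ⊔ β) p q) : wordRel α p q ∨ wordRel β p q := by
  by_contra! hn
  have heq : FreeMonoid.ofList q = FreeMonoid.ofList p :=
    Con.eq_of_sup (fun v hv => (hpq _ hα v hv).resolve_right hn.1)
      (fun v hv => (hpq _ hβ v hv).resolve_right hn.2) h
  have heq : q = p := heq
  exact hn.1 (heq ▸ hα.refl q)

end Congruences

/-- **Proposition** (`L(A')` is distributive): the lattice of fully invariant
congruences containing `θ_{A'}` is distributive. -/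
theorem LA'_distributive :
    ∀ α β γ : Con FM, IsFullyInvariant α → IsFullyInvariant β → IsFullyInvariant γ →
      θA' ≤ α → θA' ≤ β → θA' ≤ γ →
      α ⊔ (β ⊓ γ) = (α ⊔ β) ⊓ (α ⊔ γ) := by
  intro α β γ hα hβ hγ hAα hAβ hAγ
  have hle : α ⊔ (β ⊓ γ) ≤ (α ⊔ β) ⊓ (α ⊔ γ) := sup_inf_le
  have hα' := wordCong_wordRel hα hAα
  have hβ' := wordCong_wordRel hβ hAβ
  have hγ' := wordCong_wordRel hγ hAγ
  refine le_antisymm hle fun {u v} h => ?_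
  have hd := wordCong_wordRel (hα.sup (hβ.inf hγ)) (hAα.trans le_sup_left)
  have hr := wordCong_wordRel ((hα.sup hβ).inf (hα.sup hγ))
    (le_inf (hAα.trans le_sup_left) (hAα.trans le_sup_left))
  refine hr.le_of_crit hd (fun u v huv => hle huv) (fun p q hpq hpq' => ?_) h
  have h' := Con.inf_iff_and.1 hpq'
  rcases hpq.of_sup hα' hβ' h'.1 with h1 | h1
  · exact (le_sup_left : α ≤ α ⊔ (β ⊓ γ)) h1
  rcases hpq.of_sup hα' hγ' h'.2 with h2 | h2
  · exact (le_sup_left : α ≤ α ⊔ (β ⊓ γ)) h2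
  · exact (le_sup_right : β ⊓ γ ≤ α ⊔ (β ⊓ γ)) (Con.inf_iff_and.2 ⟨h1, h2⟩)
end

section
/- Proposition 5.9 (the variety P_n is fi-permutable): For every n ≥ 1, every two fully invariant congruences on F = FreeMonoid ℕ containing θ({x^n ≈ x^{n+1}, x^n y ≈ y x^n, x²y ≈ xyx}) (the equational theory of the variety P_n) permute. -/
section Combinatorics

open scoped List

/-- Two injective rankings `u`, `w` of a finite set, all of whose inversions lie in `P` or in `Q`,
are joined by a ranking `v` which preserves the common part of `u` and `w` and is such that the inversions between `u` and `v` lie in `Q` and those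
between `v` and `w` lie in `P`. Here `P` and `Q` are symmetric relations between the weights of
the points, closed under increasing the weights. -/
theorem exists_intermediate_ranking {ι : Type*} [DecidableEq ι] (e : ι → ℕ) (P Q : ℕ → ℕ → Prop)
    (hPs : ∀ a b, P a b → P b a) (hQs : ∀ a b, Q a b → Q b a)
    (hPm : ∀ a b c, b ≤ c → P a b → P a c) (hQm : ∀ a b c, b ≤ c → Q a b → Q a c)
    (u w : ι → ℕ) (A : Finset ι) (hu : Set.InjOn u A) (hw : Set.InjOn w A)
    (hinv : ∀ x ∈ A, ∀ y ∈ A, u x < u y → w y < w x → P (e x) (e y) ∨ Q (e x) (e y)) :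
    ∃ v : ι → ℚ, Set.InjOn v A ∧
      (∀ x ∈ A, ∀ y ∈ A, u x < u y → w x < w y → v x < v y) ∧
      (∀ x ∈ A, ∀ y ∈ A, u x < u y → v y < v x → Q (e x) (e y)) ∧
      (∀ x ∈ A, ∀ y ∈ A, v x < v y → w y < w x → P (e x) (e y)) := by
  induction A using Finset.induction_on_max_value e with
  | empty => exact ⟨fun _ => 0, by simp⟩
  | insert h s hs hmax ih =>
    obtain ⟨v, hv, hvuw, hvu, hvw⟩ := ih
      (hu.mono (by simp)) (hw.mono (by simp))
      (fun x hx y hy => hinv x (Finset.mem_insert_of_mem hx) y (Finset.mem_insert_of_mem hy))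
    have hne : ∀ x ∈ s, u x ≠ u h ∧ w x ≠ w h := fun x hx =>
      have hxh : x ≠ h := ne_of_mem_of_not_mem hx hs
      ⟨fun he => hxh (hu (by simp [hx]) (by simp) he),
        fun he => hxh (hw (by simp [hx]) (by simp) he)⟩
    have hinvh : ∀ x ∈ s, (u x < u h → w h < w x → P (e x) (e h) ∨ Q (e x) (e h)) ∧
        (u h < u x → w x < w h → P (e x) (e h) ∨ Q (e x) (e h)) := fun x hx =>
      ⟨hinv x (by simp [hx]) h (by simp), fun h1 h2 =>
        (hinv h (by simp) x (by simp [hx]) h1 h2).imp (hPs _ _) (hQs _ _)⟩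
    let L : ι → Prop := fun x => (u x < u h ∧ w x < w h) ∨ (u x < u h ∧ ¬ Q (e x) (e h)) ∨
      (w x < w h ∧ ¬ P (e x) (e h))
    let U : ι → Prop := fun x => (u h < u x ∧ w h < w x) ∨ (u h < u x ∧ ¬ Q (e x) (e h)) ∨
      (w h < w x ∧ ¬ P (e x) (e h))
    have hLU : ∀ x ∈ s, ∀ y ∈ s, L x → U y → v x < v y := by
      intro x hx y hy hLx hUy
      by_contra! hle
      rcases hle.lt_or_eq with hlt | heq
      · have h0 := hvuw x hx y hy
        have h1 := hvu x hx y hy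
        have h2 := fun hlw => hPs _ _ (hvw y hy x hx hlt hlw)
        have h3 := hPm (e x) _ _ (hmax y hy)
        have h4 := hQm (e x) _ _ (hmax y hy)
        have h5 := fun hp => hPm (e y) _ _ (hmax x hx) (hPs _ _ hp)
        have h6 := fun hp => hQm (e y) _ _ (hmax x hx) (hQs _ _ hp)
        have h7 := hinvh x hx
        have h8 := hinvh y hy
        have h9 : ¬ (P (e x) (e h) ∧ ¬ Q (e x) (e h) ∧ Q (e y) (e h) ∧ ¬ P (e y) (e h)) := by
          rintro ⟨p1, q1, q2, p2⟩
          rcases le_total (e x) (e y) with hxy | hxy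
          · exact p2 (hPs _ _ (hPm _ _ _ hxy (hPs _ _ p1)))
          · exact q1 (hQs _ _ (hQm _ _ _ hxy (hQs _ _ q2)))
        have h10 : ¬ (P (e y) (e h) ∧ ¬ Q (e y) (e h) ∧ Q (e x) (e h) ∧ ¬ P (e x) (e h)) := by
          rintro ⟨p1, q1, q2, p2⟩
          rcases le_total (e y) (e x) with hxy | hxy
          · exact p2 (hPs _ _ (hPm _ _ _ hxy (hPs _ _ p1)))
          · exact q1 (hQs _ _ (hQm _ _ _ hxy (hQs _ _ q2)))
        have h11 := hne x hx
        have h12 := hne y hy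
        clear hPs hQs hPm hQm hmax ih hu hw hinv hvuw hvu hvw hne hinvh hs hv
        grind
      · obtain rfl := hv hx hy heq.symm
        have := hinvh x hx
        grind
    classical
    obtain ⟨q, hq1, hq2⟩ := Order.exists_between_finsets
      (lo := (s.filter fun x => ∃ z ∈ s, L z ∧ v x ≤ v z).image v)
      (hi := (s.filter fun x => ¬ ∃ z ∈ s, L z ∧ v x ≤ v z).image v) (by
        simp only [Finset.mem_image, Finset.mem_filter]
        rintro _ ⟨x, ⟨hx, z, hz, hLz, hxz⟩, rfl⟩ _ ⟨y, ⟨hy, hny⟩, rfl⟩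
        push Not at hny
        exact hxz.trans_lt (hny z hz hLz))
    have hqL : ∀ x ∈ s, L x → v x < q := fun x hx hLx =>
      hq1 _ (Finset.mem_image_of_mem v (Finset.mem_filter.2 ⟨hx, x, hx, hLx, le_rfl⟩))
    have hqU : ∀ x ∈ s, U x → q < v x := fun x hx hUx =>
      hq2 _ (Finset.mem_image_of_mem v (Finset.mem_filter.2 ⟨hx, by
        rintro ⟨z, hz, hLz, hxz⟩
        exact (hLU z hz x hx hLz hUx).not_ge hxz⟩))
    have hqn : ∀ x ∈ s, v x ≠ q := by
      intro x hx
      by_cases hxL : ∃ z ∈ s, L z ∧ v x ≤ v z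
      · exact (hq1 _ (Finset.mem_image_of_mem v (Finset.mem_filter.2 ⟨hx, hxL⟩))).ne
      · exact (hq2 _ (Finset.mem_image_of_mem v (Finset.mem_filter.2 ⟨hx, hxL⟩))).ne'
    have hval : ∀ x ∈ s, Function.update v h q x = v x := fun x hx =>
      Function.update_of_ne (ne_of_mem_of_not_mem hx hs) _ _
    have hvalh : Function.update v h q h = q := Function.update_self ..
    refine ⟨Function.update v h q, ?_, ?_, ?_, ?_⟩
    · intro x hx y hy hxy
      rcases Finset.mem_insert.1 hx with rfl | hx' <;> rcases Finset.mem_insert.1 hy with rfl | hy'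
      · rfl
      · rw [hvalh, hval y hy'] at hxy
        exact absurd hxy.symm (hqn y hy')
      · rw [hvalh, hval x hx'] at hxy
        exact absurd hxy (hqn x hx')
      · rw [hval x hx', hval y hy'] at hxy
        exact hv hx' hy' hxy
    · intro x hx y hy hxu hxw
      rcases Finset.mem_insert.1 hx with rfl | hx' <;> rcases Finset.mem_insert.1 hy with rfl | hy'
      · exact absurd hxu (lt_irrefl _)
      · rw [hvalh, hval y hy']
        exact hqU y hy' (Or.inl ⟨hxu, hxw⟩)
      · rw [hvalh, hval x hx']
        exact hqL x hx' (Or.inl ⟨hxu, hxw⟩)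
      · rw [hval x hx', hval y hy']
        exact hvuw x hx' y hy' hxu hxw
    · intro x hx y hy hxy hlt
      rcases Finset.mem_insert.1 hx with rfl | hx' <;> rcases Finset.mem_insert.1 hy with rfl | hy'
      · exact absurd hxy (lt_irrefl _)
      · rw [hvalh, hval y hy'] at hlt
        by_contra hQ
        exact (hqU y hy' (Or.inr (Or.inl ⟨hxy, fun hc => hQ (hQs _ _ hc)⟩))).not_gt hlt
      · rw [hvalh, hval x hx'] at hlt
        by_contra hQ
        exact (hqL x hx' (Or.inr (Or.inl ⟨hxy, hQ⟩))).not_gt hlt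
      · rw [hval x hx', hval y hy'] at hlt
        exact hvu x hx' y hy' hxy hlt
    · intro x hx y hy hlt hxy
      rcases Finset.mem_insert.1 hx with rfl | hx' <;> rcases Finset.mem_insert.1 hy with rfl | hy'
      · exact absurd hxy (lt_irrefl _)
      · rw [hvalh, hval y hy'] at hlt
        by_contra hP
        exact (hqL y hy' (Or.inr (Or.inr ⟨hxy, fun hc => hP (hPs _ _ hc)⟩))).not_gt hlt
      · rw [hvalh, hval x hx'] at hlt
        by_contra hP
        exact (hqU x hx' (Or.inr (Or.inr ⟨hxy, hP⟩))).not_gt hlt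
      · rw [hval x hx', hval y hy'] at hlt
        exact hvw x hx' y hy' hlt hxy

theorem List.pair_sublist_or {ι : Type*} {l : List ι} {x y : ι} (hx : x ∈ l) (hy : y ∈ l)
    (hxy : x ≠ y) : [x, y] <+ l ∨ [y, x] <+ l := by
  obtain ⟨s, t, rfl⟩ := List.append_of_mem hx
  simp only [List.mem_append, List.mem_cons] at hy
  rcases hy with hy | hy | hy
  · exact Or.inr ((List.singleton_sublist.2 hy).append
      (List.singleton_sublist.2 (List.mem_cons_self (a := x) (l := t))))
  · exact absurd hy.symm hxy
  · exact Or.inl (((List.singleton_sublist.2 hy).cons_cons x).trans (List.sublist_append_right _ _))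

theorem List.Nodup.pairwise_idxOf_lt {ι : Type*} [DecidableEq ι] {l : List ι} (hl : l.Nodup) :
    l.Pairwise fun x y => l.idxOf x < l.idxOf y := by
  rw [List.pairwise_iff_getElem]
  intro i j hi hj hij
  rwa [hl.idxOf_getElem, hl.idxOf_getElem]

theorem List.Nodup.idxOf_lt_idxOf_iff {ι : Type*} [DecidableEq ι] {l : List ι} (hl : l.Nodup)
    {x y : ι} (hx : x ∈ l) (hy : y ∈ l) : l.idxOf x < l.idxOf y ↔ [x, y] <+ l := by
  have key : ∀ {x y}, [x, y] <+ l → l.idxOf x < l.idxOf y := fun h =>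
    List.pairwise_iff_forall_sublist.1 hl.pairwise_idxOf_lt h
  refine ⟨fun h => ?_, key⟩
  rcases List.pair_sublist_or hx hy (by rintro rfl; exact lt_irrefl _ h) with h' | h'
  · exact h'
  · exact absurd (key h') h.not_gt

/-- List form of `exists_intermediate_ranking`. -/
theorem List.exists_intermediate {ι : Type*} [DecidableEq ι] (e : ι → ℕ) (P Q : ℕ → ℕ → Prop)
    (hPs : ∀ a b, P a b → P b a) (hQs : ∀ a b, Q a b → Q b a)
    (hPm : ∀ a b c, b ≤ c → P a b → P a c) (hQm : ∀ a b c, b ≤ c → Q a b → Q a c)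
    {k l : List ι} (hk : k.Nodup) (hl : l.Nodup) (hkl : k.Perm l)
    (hinv : ∀ x y, [x, y] <+ k → [y, x] <+ l → P (e x) (e y) ∨ Q (e x) (e y)) :
    ∃ m : List ι, k.Perm m ∧ (∀ x y, [x, y] <+ k → [y, x] <+ m → Q (e x) (e y)) ∧
      (∀ x y, [x, y] <+ m → [y, x] <+ l → P (e x) (e y)) := by
  have hmem : ∀ x ∈ k.toFinset, x ∈ k ∧ x ∈ l := fun x hx =>
    ⟨List.mem_toFinset.1 hx, hkl.mem_iff.1 (List.mem_toFinset.1 hx)⟩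
  obtain ⟨v, hv, -, hvk, hvl⟩ := exists_intermediate_ranking e P Q hPs hQs hPm hQm
    (fun x => k.idxOf x) (fun x => l.idxOf x) k.toFinset
    (fun x hx y hy h => (List.idxOf_inj (hmem x hx).1).1 h)
    (fun x hx y hy h => (List.idxOf_inj (hmem x hx).2).1 h)
    (fun x hx y hy h1 h2 => hinv x y
      ((hk.idxOf_lt_idxOf_iff (hmem x hx).1 (hmem y hy).1).1 h1)
      ((hl.idxOf_lt_idxOf_iff (hmem y hy).2 (hmem x hx).2).1 h2))
  let r : ι → ι → Prop := fun x y => v x ≤ v y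
  have : Std.Total r := ⟨fun _ _ => le_total _ _⟩
  have : IsTrans ι r := ⟨fun _ _ _ => le_trans⟩
  have hperm : k.Perm (k.insertionSort r) := (List.perm_insertionSort r k).symm
  have hlt : ∀ {x y}, [x, y] <+ k.insertionSort r → v x < v y := by
    intro x y hxy
    refine lt_of_le_of_ne
      (List.pairwise_iff_forall_sublist.1 (List.pairwise_insertionSort r k) hxy) fun he => ?_
    have hx : x ∈ k := hperm.mem_iff.2 (hxy.subset (by simp))
    have hy : y ∈ k := hperm.mem_iff.2 (hxy.subset (by simp))
    obtain rfl := hv (by simpa using hx) (by simpa using hy) he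
    have := (hperm.nodup_iff.1 hk).sublist hxy
    simp at this
  refine ⟨k.insertionSort r, hperm, fun x y h1 h2 => ?_, fun x y h1 h2 => ?_⟩
  · have hx : x ∈ k := h1.subset (by simp)
    have hy : y ∈ k := h1.subset (by simp)
    exact hvk x (by simpa using hx) y (by simpa using hy)
      ((hk.idxOf_lt_idxOf_iff hx hy).2 h1) (hlt h2)
  · have hx : x ∈ l := h2.subset (by simp)
    have hy : y ∈ l := h2.subset (by simp)
    exact hvl x (by simpa [hkl.mem_iff] using hx) y (by simpa [hkl.mem_iff] using hy)
      (hlt h1) ((hl.idxOf_lt_idxOf_iff hy hx).2 h2)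

end Combinatorics

section NormalForms

open scoped List

/-- The word `x₁ ^ e x₁ * ⋯ * xₖ ^ e xₖ` for `l = [x₁, …, xₖ]`. -/
def powProd (l : List ℕ) (e : ℕ → ℕ) : FM := (l.map fun x => FreeMonoid.of x ^ e x).prod

@[simp] theorem powProd_nil (e : ℕ → ℕ) : powProd [] e = 1 := rfl

@[simp] theorem powProd_cons (x : ℕ) (l : List ℕ) (e : ℕ → ℕ) :
    powProd (x :: l) e = FreeMonoid.of x ^ e x * powProd l e := by simp [powProd]

@[simp] theorem powProd_append (k l : List ℕ) (e : ℕ → ℕ) :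
    powProd (k ++ l) e = powProd k e * powProd l e := by simp [powProd]

theorem powProd_congr {l : List ℕ} {e f : ℕ → ℕ} (h : ∀ x ∈ l, e x = f x) :
    powProd l e = powProd l f := by
  unfold powProd
  rw [List.map_congr_left fun x hx => by rw [h x hx]]

/-- The endomorphism sending `x` to the letter `0`, `y` to the letter `1` and erasing all other
letters. -/
def proj (x y : ℕ) : FM →* FM :=
  FreeMonoid.lift fun z => if z = x then FreeMonoid.of 0 else if z = y then FreeMonoid.of 1 else 1

theorem proj_powProd_eq_one {x y : ℕ} {l : List ℕ} (hx : x ∉ l) (hy : y ∉ l) (e : ℕ → ℕ) :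
    proj x y (powProd l e) = 1 := by
  induction l with
  | nil => simp
  | cons z l ih =>
    simp only [List.mem_cons, not_or] at hx hy
    rw [powProd_cons, map_mul, ih hx.2 hy.2]
    simp [proj, Ne.symm hx.1, Ne.symm hy.1]

theorem proj_powProd_of_mem {x : ℕ} {l : List ℕ} (hl : l.Nodup) (hx : x ∈ l) (e : ℕ → ℕ) :
    proj x x (powProd l e) = FreeMonoid.of 0 ^ e x := by
  obtain ⟨s, t, rfl⟩ := List.append_of_mem hx
  have h : x ∉ s ∧ x ∉ t := by grind
  rw [powProd_append, powProd_cons, map_mul, map_mul, proj_powProd_eq_one h.1 h.1,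
    proj_powProd_eq_one h.2 h.2]
  simp [proj]

theorem proj_powProd_of_sublist {x y : ℕ} {l : List ℕ} (hl : l.Nodup) (h : [x, y] <+ l)
    (e : ℕ → ℕ) : proj x y (powProd l e) = FreeMonoid.of 0 ^ e x * FreeMonoid.of 1 ^ e y := by
  obtain ⟨r, s, rfl, hx, hy⟩ := List.cons_sublist_iff.1 h
  obtain ⟨a, b, rfl⟩ := List.append_of_mem hx
  obtain ⟨c, d, rfl⟩ := List.append_of_mem (List.singleton_sublist.1 hy)
  have hn : x ∉ a ∧ x ∉ b ∧ x ∉ c ∧ x ∉ d ∧ y ∉ a ∧ y ∉ b ∧ y ∉ c ∧ y ∉ d ∧ y ≠ x := by grind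
  obtain ⟨h1, h2, h3, h4, h5, h6, h7, h8, h9⟩ := hn
  simp only [powProd_append, powProd_cons, map_mul, proj_powProd_eq_one h1 h5,
    proj_powProd_eq_one h2 h6, proj_powProd_eq_one h3 h7, proj_powProd_eq_one h4 h8]
  simp [proj, h9]

theorem proj_powProd_of_sublist_swap {x y : ℕ} {l : List ℕ} (hl : l.Nodup) (h : [y, x] <+ l)
    (e : ℕ → ℕ) : proj x y (powProd l e) = FreeMonoid.of 1 ^ e y * FreeMonoid.of 0 ^ e x := by
  obtain ⟨r, s, rfl, hx, hy⟩ := List.cons_sublist_iff.1 h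
  obtain ⟨a, b, rfl⟩ := List.append_of_mem hx
  obtain ⟨c, d, rfl⟩ := List.append_of_mem (List.singleton_sublist.1 hy)
  have hn : x ∉ a ∧ x ∉ b ∧ x ∉ c ∧ x ∉ d ∧ y ∉ a ∧ y ∉ b ∧ y ∉ c ∧ y ∉ d ∧ y ≠ x := by grind
  obtain ⟨h1, h2, h3, h4, h5, h6, h7, h8, h9⟩ := hn
  simp only [powProd_append, powProd_cons, map_mul, proj_powProd_eq_one h1 h5,
    proj_powProd_eq_one h2 h6, proj_powProd_eq_one h3 h7, proj_powProd_eq_one h4 h8]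
  simp [proj, h9]

end NormalForms

section FullyInvariant

open scoped List

/-- `θ` satisfies `x ^ a ≈ x ^ b`. -/
def PowRel (θ : Con FM) (a b : ℕ) : Prop := θ (FreeMonoid.of 0 ^ a) (FreeMonoid.of 0 ^ b)

/-- `θ` satisfies `x ^ a * y ^ b ≈ y ^ b * x ^ a`. -/
def CommRel (θ : Con FM) (a b : ℕ) : Prop :=
  θ (FreeMonoid.of 0 ^ a * FreeMonoid.of 1 ^ b) (FreeMonoid.of 1 ^ b * FreeMonoid.of 0 ^ a)

variable {θ : Con FM} {n : ℕ}

theorem IsFullyInvariant.subst (hθ : IsFullyInvariant θ) {u v : FM} (h : θ u v) (f : ℕ → FM) :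
    θ (FreeMonoid.lift f u) (FreeMonoid.lift f v) := hθ _ _ _ h

theorem PowRel.word (hθ : IsFullyInvariant θ) {a b : ℕ} (h : PowRel θ a b) (u : FM) :
    θ (u ^ a) (u ^ b) := by
  simpa using hθ.subst h fun _ => u

theorem CommRel.words (hθ : IsFullyInvariant θ) {a b : ℕ} (h : CommRel θ a b) (u v : FM) :
    θ (u ^ a * v ^ b) (v ^ b * u ^ a) := by
  simpa using hθ.subst h fun i => if i = 0 then u else v

theorem CommRel.symm (hθ : IsFullyInvariant θ) {a b : ℕ} (h : CommRel θ a b) : CommRel θ b a :=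
  θ.symm (h.words hθ (FreeMonoid.of 1) (FreeMonoid.of 0))

theorem CommRel.congr_left {a a' b : ℕ} (h : CommRel θ a b) (ha : PowRel θ a a') :
    CommRel θ a' b :=
  θ.trans (θ.mul (θ.symm ha) (θ.refl _)) (θ.trans h (θ.mul (θ.refl _) ha))

theorem PowRel.add_right {a b : ℕ} (h : PowRel θ a b) (k : ℕ) : PowRel θ (a + k) (b + k) := by
  unfold PowRel at *
  rw [pow_add, pow_add]
  exact θ.mul h (θ.refl _)

theorem rel_of_mem_basisP (hP : θP n ≤ θ) {p : FM × FM} (hp : p ∈ basisP n) : θ p.1 p.2 :=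
  hP fun _ hc => hc.2 p hp

theorem sq_mul_rel (hθ : IsFullyInvariant θ) (hP : θP n ≤ θ) (u v : FM) :
    θ (u ^ 2 * v) (u * v * u) := by
  have h := rel_of_mem_basisP hP (p := (xL^2*yL, xL*yL*xL)) (by simp [basisP])
  simpa [xL, yL] using hθ.subst h fun i => if i = 0 then u else v

theorem pow_succ_mul_rel (hθ : IsFullyInvariant θ) (hP : θP n ≤ θ) {a : ℕ} (ha : 1 ≤ a)
    (u v : FM) : θ (u ^ (a + 1) * v) (u ^ a * v * u) := by
  obtain ⟨b, rfl⟩ := Nat.exists_eq_add_of_le' ha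
  have h := θ.mul (θ.refl (u ^ b)) (sq_mul_rel hθ hP u v)
  convert h using 1
  · rw [← mul_assoc, ← pow_add]
  · rw [pow_succ]; simp only [mul_assoc]

theorem powRel_add (hP : θP n ≤ θ) (k : ℕ) : PowRel θ (n + k) n := by
  have h1 : PowRel θ n (n + 1) :=
    rel_of_mem_basisP hP (p := (xL^n, xL^(n+1))) (by simp [basisP])
  induction k with
  | zero => exact θ.refl _
  | succ k ih => exact θ.trans (ih.add_right 1) (θ.symm h1)

theorem powRel_of_le (hP : θP n ≤ θ) {a : ℕ} (ha : n ≤ a) : PowRel θ a n := by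
  obtain ⟨k, rfl⟩ := Nat.exists_eq_add_of_le ha
  exact powRel_add hP k

theorem PowRel.mono (hP : θP n ≤ θ) {a b : ℕ} (h : PowRel θ a n) (hab : a ≤ b) :
    PowRel θ b n := by
  obtain ⟨k, rfl⟩ := Nat.exists_eq_add_of_le hab
  exact θ.trans (h.add_right k) (powRel_add hP k)

theorem PowRel.collapse_of_lt (hP : θP n ≤ θ) {a b : ℕ} (h : PowRel θ a b) (hab : a < b) :
    PowRel θ a n := by
  obtain ⟨d, rfl⟩ := Nat.exists_eq_add_of_le hab.le
  have hk : ∀ k, PowRel θ a (a + k * d) := by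
    intro k
    induction k with
    | zero => simpa [PowRel] using θ.refl _
    | succ k ih =>
      have := θ.trans h (ih.add_right d)
      rwa [add_assoc, ← Nat.succ_mul] at this
  exact θ.trans (hk n) (powRel_of_le hP (by nlinarith))

theorem PowRel.collapse (hP : θP n ≤ θ) {a b : ℕ} (h : PowRel θ a b) (hab : a ≠ b) :
    PowRel θ a n := by
  rcases hab.lt_or_gt with hlt | hlt
  · exact h.collapse_of_lt hP hlt
  · exact θ.trans h (PowRel.collapse_of_lt hP (θ.symm h) hlt)

theorem PowRel.rel_of_zero (hθ : IsFullyInvariant θ) (hP : θP n ≤ θ) (h : PowRel θ 0 n)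
    (u v : FM) : θ u v := by
  have h1 : PowRel θ 0 1 := θ.trans h (θ.symm (h.mono hP zero_le_one))
  have hu := h1.word hθ u
  have hv := h1.word hθ v
  simp only [pow_zero, pow_one] at hu hv
  exact θ.trans (θ.symm hu) hv

theorem PowRel.commRel (hθ : IsFullyInvariant θ) (hP : θP n ≤ θ) {a : ℕ} (h : PowRel θ a n)
    (b : ℕ) : CommRel θ a b := by
  have h1 := rel_of_mem_basisP hP (p := (xL^n * yL, yL * xL^n)) (by simp [basisP])
  have h2 : CommRel θ n b := by
    simpa [xL, yL, CommRel] using hθ.subst h1 fun i => if i = 0 then FreeMonoid.of 0 else FreeMonoid.of 1 ^ b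
  exact h2.congr_left (θ.symm h)

theorem CommRel.mono (hθ : IsFullyInvariant θ) (hP : θP n ≤ θ) {a b c : ℕ} (ha : 1 ≤ a)
    (hab : a ≤ b) (h : CommRel θ a c) : CommRel θ b c := by
  induction b, hab using Nat.le_induction with
  | base => exact h
  | succ b hab ih =>
    refine θ.trans (pow_succ_mul_rel hθ hP (ha.trans hab) _ _) ?_
    rw [pow_succ, ← mul_assoc]
    exact θ.mul ih (θ.refl _)

theorem exists_powProd (hθ : IsFullyInvariant θ) (hP : θP n ≤ θ) (u : FM) :
    ∃ (l : List ℕ) (e : ℕ → ℕ), l.Nodup ∧ (∀ x, 1 ≤ e x) ∧ θ u (powProd l e) := by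
  induction u using List.reverseRecOn with
  | nil => exact ⟨[], fun _ => 1, List.nodup_nil, fun _ => le_rfl, θ.refl _⟩
  | append_singleton u y ih =>
    obtain ⟨l, e, hl, he, h⟩ := ih
    have h' : θ (FreeMonoid.ofList (u ++ [y])) (powProd l e * FreeMonoid.of y) := θ.mul h (θ.refl _)
    by_cases hy : y ∈ l
    · obtain ⟨s, t, rfl⟩ := List.append_of_mem hy
      have hs : y ∉ s ∧ y ∉ t := by grind
      refine ⟨s ++ y :: t, Function.update e y (e y + 1), hl, fun x => ?_, θ.trans h' ?_⟩
      · by_cases hx : x = y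
        · subst hx; simp
        · simpa [hx] using he x
      · have hc : ∀ r : List ℕ, y ∉ r →
            powProd r (Function.update e y (e y + 1)) = powProd r e := fun r hr =>
          powProd_congr fun x hx => Function.update_of_ne (ne_of_mem_of_not_mem hx hr) _ _
        simp only [powProd_append, powProd_cons, hc s hs.1, hc t hs.2, Function.update_self,
          mul_assoc]
        refine θ.mul (θ.refl _) (θ.symm ?_)
        simpa only [mul_assoc] using pow_succ_mul_rel hθ hP (he y) (FreeMonoid.of y) (powProd t e)
    · refine ⟨l ++ [y], Function.update e y 1, ?_, fun x => ?_, θ.trans h' ?_⟩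
      · grind
      · by_cases hx : x = y
        · subst hx; simp
        · simpa [hx] using he x
      · have hc : powProd l (Function.update e y 1) = powProd l e :=
          powProd_congr fun x hx => Function.update_of_ne (ne_of_mem_of_not_mem hx hy) _ _
        simpa [hc] using θ.refl _

theorem mem_of_powProd_rel (hθ : IsFullyInvariant θ) (hP : θP n ≤ θ) (h0 : ¬ PowRel θ 0 n)
    {k l : List ℕ} {e f : ℕ → ℕ} (hk : k.Nodup) (he : ∀ x, 1 ≤ e x)
    (h : θ (powProd k e) (powProd l f)) {x : ℕ} (hx : x ∈ k) : x ∈ l := by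
  by_contra hxl
  have h1 := hθ (proj x x) _ _ h
  rw [proj_powProd_of_mem hk hx, proj_powProd_eq_one hxl hxl] at h1
  have h2 : PowRel θ 0 (e x) := by simpa [PowRel] using θ.symm h1
  exact h0 (h2.collapse_of_lt hP (he x))

theorem perm_of_powProd_rel (hθ : IsFullyInvariant θ) (hP : θP n ≤ θ) (h0 : ¬ PowRel θ 0 n)
    {k l : List ℕ} {e f : ℕ → ℕ} (hk : k.Nodup) (hl : l.Nodup) (he : ∀ x, 1 ≤ e x)
    (hf : ∀ x, 1 ≤ f x) (h : θ (powProd k e) (powProd l f)) : k.Perm l :=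
  (List.perm_ext_iff_of_nodup hk hl).2 fun _ =>
    ⟨mem_of_powProd_rel hθ hP h0 hk he h, mem_of_powProd_rel hθ hP h0 hl hf (θ.symm h)⟩

theorem powRel_of_powProd_rel (hθ : IsFullyInvariant θ) {k l : List ℕ} {e f : ℕ → ℕ}
    (hk : k.Nodup) (hl : l.Nodup) (h : θ (powProd k e) (powProd l f)) {x : ℕ} (hxk : x ∈ k)
    (hxl : x ∈ l) : PowRel θ (e x) (f x) := by
  have h1 := hθ (proj x x) _ _ h
  rwa [proj_powProd_of_mem hk hxk, proj_powProd_of_mem hl hxl] at h1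

theorem commRel_of_powProd_rel (hθ : IsFullyInvariant θ) {k l : List ℕ} {e f : ℕ → ℕ}
    (hk : k.Nodup) (hl : l.Nodup) (h : θ (powProd k e) (powProd l f)) {x y : ℕ}
    (hxy : [x, y] <+ k) (hyx : [y, x] <+ l) : CommRel θ (e x) (e y) := by
  have h1 := hθ (proj x y) _ _ h
  rw [proj_powProd_of_sublist hk hxy, proj_powProd_of_sublist_swap hl hyx] at h1
  have hx := powRel_of_powProd_rel hθ hk hl h (hxy.subset (by simp : x ∈ _))
    (hyx.subset (by simp))
  have hy := powRel_of_powProd_rel hθ hk hl h (hxy.subset (by simp : y ∈ _))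
    (hyx.subset (by simp))
  exact θ.trans h1 (θ.symm (θ.mul (hy.word hθ _) hx))

theorem powProd_rel_of_powRel (hθ : IsFullyInvariant θ) {l : List ℕ} {e f : ℕ → ℕ}
    (h : ∀ x ∈ l, PowRel θ (e x) (f x)) : θ (powProd l e) (powProd l f) := by
  induction l with
  | nil => exact θ.refl _
  | cons x l ih =>
    rw [powProd_cons, powProd_cons]
    exact θ.mul ((h x (by simp)).word hθ _) (ih fun y hy => h y (by simp [hy]))

theorem pow_mul_powProd_rel (hθ : IsFullyInvariant θ) {x : ℕ} {l : List ℕ} {e : ℕ → ℕ}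
    (h : ∀ y ∈ l, CommRel θ (e x) (e y)) :
    θ (FreeMonoid.of x ^ e x * powProd l e) (powProd l e * FreeMonoid.of x ^ e x) := by
  induction l with
  | nil => simpa using θ.refl _
  | cons y l ih =>
    rw [powProd_cons, ← mul_assoc]
    refine θ.trans (θ.mul ((h y (by simp)).words hθ _ _) (θ.refl _)) ?_
    rw [mul_assoc, mul_assoc]
    exact θ.mul (θ.refl _) (ih fun z hz => h z (by simp [hz]))

theorem powProd_rel_of_perm (hθ : IsFullyInvariant θ) {k l : List ℕ} {e : ℕ → ℕ} (hkl : k.Perm l)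
    (h : ∀ x y, [x, y] <+ k → [y, x] <+ l → CommRel θ (e x) (e y)) :
    θ (powProd k e) (powProd l e) := by
  induction k generalizing l with
  | nil => rw [List.nil_perm.1 hkl]; exact θ.refl _
  | cons x k ih =>
    obtain ⟨s, t, rfl⟩ := List.append_of_mem (hkl.mem_iff.1 (List.mem_cons_self (a := x) (l := k)))
    have hperm : k.Perm (s ++ t) := (hkl.trans List.perm_middle).cons_inv
    have hs : ∀ y ∈ s, CommRel θ (e x) (e y) := fun y hy =>
      h x y ((List.singleton_sublist.2 (hperm.mem_iff.2 (by simp [hy]))).cons_cons x)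
        ((List.singleton_sublist.2 hy).append
          (List.singleton_sublist.2 (List.mem_cons_self (a := x) (l := t))))
    have hst : θ (powProd k e) (powProd (s ++ t) e) := ih hperm fun y z h1 h2 =>
      h y z (h1.cons x) (h2.trans ((List.sublist_cons_self x t).append_left s))
    rw [powProd_cons]
    refine θ.trans (θ.mul (θ.refl _) hst) ?_
    simp only [powProd_append, powProd_cons, ← mul_assoc]
    exact θ.mul (pow_mul_powProd_rel hθ hs) (θ.refl _)

end FullyInvariant

/-- If every collapse of powers in `β` is one in `α`, then `α ∘ β ⊆ β ∘ α`. -/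
theorem comp_swap_of_collapse {n : ℕ} {α β : Con FM} (hα : IsFullyInvariant α)
    (hβ : IsFullyInvariant β) (hPα : θP n ≤ α) (hPβ : θP n ≤ β)
    (hcol : ∀ a, PowRel β a n → PowRel α a n) {u v w : FM} (huv : α u v) (hvw : β v w) :
    ∃ v', β u v' ∧ α v' w := by
  by_cases hα0 : PowRel α 0 n
  · exact ⟨u, β.refl u, hα0.rel_of_zero hα hPα u w⟩
  by_cases hβ0 : PowRel β 0 n
  · exact ⟨w, hβ0.rel_of_zero hβ hPβ u w, α.refl w⟩
  have hF : IsFullyInvariant (α ⊓ β) := fun σ a b h => ⟨hα σ a b h.1, hβ σ a b h.2⟩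
  have hFP : θP n ≤ α ⊓ β := le_inf hPα hPβ
  obtain ⟨ku, eu, hku, heu, hu⟩ := exists_powProd hF hFP u
  obtain ⟨kv, ev, hkv, hev, hv⟩ := exists_powProd hF hFP v
  obtain ⟨kw, ew, hkw, hew, hw⟩ := exists_powProd hF hFP w
  have huv' : α (powProd ku eu) (powProd kv ev) := α.trans (α.symm hu.1) (α.trans huv hv.1)
  have hvw' : β (powProd kv ev) (powProd kw ew) := β.trans (β.symm hv.2) (β.trans hvw hw.2)
  have hpuv := perm_of_powProd_rel hα hPα hα0 hku hkv heu hev huv'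
  have hpvw := perm_of_powProd_rel hβ hPβ hβ0 hkv hkw hev hew hvw'
  have hEuv : ∀ x ∈ ku, PowRel α (eu x) (ev x) := fun x hx =>
    powRel_of_powProd_rel hα hku hkv huv' hx (hpuv.mem_iff.1 hx)
  have hEvw : ∀ x ∈ kv, PowRel α (ev x) (ew x) := by
    intro x hx
    have h := powRel_of_powProd_rel hβ hkv hkw hvw' hx (hpvw.mem_iff.1 hx)
    by_cases hxx : ev x = ew x
    · rw [hxx]; exact α.refl _
    · exact α.trans (hcol _ (h.collapse hPβ hxx))
        (α.symm (hcol _ (PowRel.collapse hPβ (β.symm h) (Ne.symm hxx))))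
  let C : Con FM → ℕ → ℕ → Prop := fun θ a b => 1 ≤ a ∧ 1 ≤ b ∧ CommRel θ a b
  have hCs : ∀ {θ : Con FM}, IsFullyInvariant θ → ∀ a b, C θ a b → C θ b a :=
    fun hθ a b h => ⟨h.2.1, h.1, h.2.2.symm hθ⟩
  have hCm : ∀ {θ : Con FM}, IsFullyInvariant θ → θP n ≤ θ →
      ∀ a b c, b ≤ c → C θ a b → C θ a c := fun hθ hP a b c hbc h =>
    ⟨h.1, h.2.1.trans hbc, ((h.2.2.symm hθ).mono hθ hP h.2.1 hbc).symm hθ⟩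
  obtain ⟨m, hm, hmu, hmw⟩ := List.exists_intermediate eu (C α) (C β) (hCs hα) (hCs hβ)
    (hCm hα hPα) (hCm hβ hPβ) hku hkw (hpuv.trans hpvw) (by
      intro x y hxy hyx
      have hxu : x ∈ ku := hxy.subset (by simp)
      have hyu : y ∈ ku := hxy.subset (by simp)
      have hne : x ≠ y := by
        rintro rfl
        have := hku.sublist hxy
        simp at this
      by_cases hx : eu x = ev x
      · by_cases hy : eu y = ev y
        · rcases List.pair_sublist_or (hpuv.mem_iff.1 hxu) (hpuv.mem_iff.1 hyu) hne with hs | hs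
          · have := commRel_of_powProd_rel hβ hkv hkw hvw' hs hyx
            rw [← hx, ← hy] at this
            exact Or.inr ⟨heu x, heu y, this⟩
          · exact Or.inl ⟨heu x, heu y, commRel_of_powProd_rel hα hku hkv huv' hxy hs⟩
        · exact Or.inl ⟨heu x, heu y,
            (((hEuv y hyu).collapse hPα hy).commRel hα hPα (eu x)).symm hα⟩
      · exact Or.inl ⟨heu x, heu y, ((hEuv x hxu).collapse hPα hx).commRel hα hPα (eu y)⟩)
  refine ⟨powProd m eu, ?_, ?_⟩
  · exact β.trans hu.2 (powProd_rel_of_perm hβ hm fun x y h1 h2 => (hmu x y h1 h2).2.2)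
  · refine α.trans ?_ (α.symm hw.1)
    refine α.trans (powProd_rel_of_perm hα (hm.symm.trans (hpuv.trans hpvw))
      fun x y h1 h2 => (hmw x y h1 h2).2.2) ?_
    refine powProd_rel_of_powRel hα fun x hx => ?_
    have hxv : x ∈ kv := hpvw.mem_iff.2 hx
    exact α.trans (hEuv x (hpuv.mem_iff.2 hxv)) (hEvw x hxv)

/-- **Proposition 5.9.** For every `n ≥ 1`, the variety `P_n` is fi-permutable:
any two fully invariant congruences containing `θ_{P_n}` permute. -/
theorem Pn_fi_permutable (n : ℕ) (hn : 1 ≤ n) :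
    ∀ α β : Con FM, IsFullyInvariant α → IsFullyInvariant β →
      θP n ≤ α → θP n ≤ β → Permute α β := by
  intro α β hα hβ hPα hPβ
  have hcomp : (∀ u v w, α u v → β v w → ∃ v', β u v' ∧ α v' w) ∧
      (∀ u v w, β u v → α v w → ∃ v', α u v' ∧ β v' w) := by
    have flip : ∀ {γ δ : Con FM}, (∀ u v w, γ u v → δ v w → ∃ v', δ u v' ∧ γ v' w) →
        ∀ u v w, δ u v → γ v w → ∃ v', γ u v' ∧ δ v' w := by
      intro γ δ h u v w huv hvw
      obtain ⟨v', h1, h2⟩ := h w v u (γ.symm hvw) (δ.symm huv)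
      exact ⟨v', γ.symm h2, δ.symm h1⟩
    by_cases hcol : ∀ a, PowRel β a n → PowRel α a n
    · have h := fun u v w => comp_swap_of_collapse hα hβ hPα hPβ hcol (u := u) (v := v) (w := w)
      exact ⟨h, flip h⟩
    · push Not at hcol
      obtain ⟨a, haβ, haα⟩ := hcol
      have h := fun u v w => comp_swap_of_collapse hβ hα hPβ hPα (fun b hb =>
        haβ.mono hPβ (le_of_not_ge fun hba => haα (hb.mono hPα hba))) (u := u) (v := v) (w := w)
      exact ⟨flip h, h⟩
  funext u w
  refine propext ⟨?_, ?_⟩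
  · rintro ⟨v, huv, hvw⟩
    exact hcomp.1 u v w huv hvw
  · rintro ⟨v, huv, hvw⟩
    exact hcomp.2 u v w huv hvw
end
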